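/- There exist universal constants C, γ, C₁, C₂, D₁, D₂ > 0 with the following property. Let s ≥ 2, m ≥ 2, and n ≥ C·s·(ln s)³·ln m. Draw sampling points x_1, …, x_n ∈ [−1,1] independently from the Chebyshev measure, let Φ ∈ ℝ^{n×m} have entries Φ_{j,k} = L_{k−1}(x_j), and let W ∈ ℝ^{n×n} be the diagonal matrix with W_{j,j} = √(π/2)·(1−x_j²)^{1/4}. Then with probability at least 1 − m^{−γ (ln s)³} over the samples, the following holds simultaneously for all c ∈ ℝ^m, all ε ≥ 0, and all η ∈ ℝ^n with ‖Wη‖_∞ ≤ ε: setting Y = Φc + η, every minimizer c* of ‖z‖₁ over {z ∈ ℝ^m : ‖WΦz − WY‖₂ ≤ √n·ε} satisfies ‖c − c*‖₂ ≤ C₁·σ_s(c)₁/√s + D₁·ε and ‖c − c*‖₁ ≤ C₂·σ_s(c)₁ + D₂·√s·ε. -/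

import Mathlib

open MeasureTheory

/-- The `k`-th Legendre polynomial, via Rodrigues' formula
`P_k(x) = (1/(2^k k!)) (d/dx)^k (x²−1)^k`. -/
noncomputable def legendreP (k : ℕ) (x : ℝ) : ℝ :=
  (1 / (2 ^ k * (Nat.factorial k))) * iteratedDeriv k (fun t => (t ^ 2 - 1) ^ k) x

/-- The `k`-th orthonormal Legendre polynomial `L_k = √(k + 1/2)·P_k` on `[−1,1]`. -/
noncomputable def legendreL (k : ℕ) (x : ℝ) : ℝ :=
  Real.sqrt (k + 1 / 2) * legendreP k x

/-- The Chebyshev (arcsine) probability measure `dν(x) = π^{−1}(1−x²)^{−1/2} dx`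
on `[−1,1]`. -/
noncomputable def chebMeasure : Measure ℝ :=
  (volume.restrict (Set.Ioo (-1 : ℝ) 1)).withDensity
    (fun x => ENNReal.ofReal (Real.pi⁻¹ * (1 - x ^ 2) ^ (-(1 : ℝ) / 2)))

/-- A vector `x ∈ ℝ^m` is `s`-sparse if at most `s` of its coordinates are nonzero. -/
def IsSparse {m : ℕ} (s : ℕ) (x : Fin m → ℝ) : Prop :=
  ({i | x i ≠ 0} : Set (Fin m)).ncard ≤ s

/-- The Euclidean (`ℓ₂`) norm. -/
noncomputable def l2norm {m : ℕ} (x : Fin m → ℝ) : ℝ :=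
  Real.sqrt (∑ i, (x i) ^ 2)

/-- The `ℓ₁` norm. -/
noncomputable def l1norm {m : ℕ} (x : Fin m → ℝ) : ℝ :=
  ∑ i, |x i|

/-- `σ_s(x)₁`, the error of best `s`-term approximation in `ℓ₁`. -/
noncomputable def bestApproxErr {m : ℕ} (s : ℕ) (x : Fin m → ℝ) : ℝ :=
  sInf {t : ℝ | ∃ z : Fin m → ℝ, IsSparse s z ∧ t = l1norm (x - z)}

/-- The random Legendre sampling matrix `Φ_{j,k} = L_{k−1}(x_j)`
(with columns indexed by `Fin m`, i.e. `0`-based). -/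
noncomputable def legMatrix (n m : ℕ) (xs : Fin n → ℝ) : Matrix (Fin n) (Fin m) ℝ :=
  Matrix.of fun j k => legendreL (k : ℕ) (xs j)

/-- Diagonal entries of the preconditioner `W_{j,j} = √(π/2)·(1−x_j²)^{1/4}`. -/
noncomputable def Wdiag (n : ℕ) (xs : Fin n → ℝ) (j : Fin n) : ℝ :=
  Real.sqrt (Real.pi / 2) * (1 - (xs j) ^ 2) ^ ((1 : ℝ) / 4)

open Polynomial in
noncomputable def rodF (k : ℕ) : ℝ[X] := (X ^ 2 - 1) ^ k

open Polynomial in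
noncomputable def rodD (k j : ℕ) : ℝ[X] := derivative^[j] (rodF k)

open Polynomial in
lemma rodD_succ (k j : ℕ) : derivative (rodD k j) = rodD k (j + 1) := by
  unfold rodD; rw [Function.iterate_succ_apply']

open Polynomial in
lemma rodD_zero_eq (k : ℕ) : (X ^ 2 - 1) * rodD k 1 = C (2 * (k : ℝ)) * X * rodD k 0 := by
  rw [← rodD_succ]
  simp only [rodD, rodF, Function.iterate_zero, id_eq]
  cases k with
  | zero => simp
  | succ k =>
    simp only [derivative_pow, derivative_sub, derivative_X, derivative_one, Nat.add_sub_cancel, map_mul, map_natCast, map_ofNat]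
    push_cast
    simp
    ring

open Polynomial in
lemma rodD_rec (k j : ℕ) : (X ^ 2 - 1) * rodD k (j + 2) + C (2 * ((j : ℝ) + 1)) * X * rodD k (j + 1)
    + C ((j : ℝ) * (j + 1)) * rodD k j =
    C (2 * (k : ℝ)) * X * rodD k (j + 1) + C (2 * (k : ℝ) * (j + 1)) * rodD k j := by
  induction j with
  | zero =>
    have h := congrArg derivative (rodD_zero_eq k)
    simp only [derivative_mul, derivative_sub, derivative_X_pow, derivative_one, derivative_C, derivative_X, rodD_succ] at h
    simp only [map_mul, map_add, map_natCast, map_ofNat, map_one] at h ⊢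
    push_cast at h ⊢
    simp at h ⊢
    linear_combination h
  | succ j ih =>
    have h := congrArg derivative ih
    simp only [derivative_mul, derivative_add, derivative_sub, derivative_X_pow, derivative_one, derivative_C, derivative_X, rodD_succ] at h
    simp only [map_mul, map_add, map_natCast, map_ofNat, map_one] at h ⊢
    push_cast at h ⊢
    simp at h ⊢
    linear_combination h

open Polynomial in
lemma rodD_ode (k : ℕ) (x : ℝ) : (1 - x ^ 2) * (rodD k (k + 2)).eval x - 2 * x * (rodD k (k + 1)).eval x
    + k * (k + 1) * (rodD k k).eval x = 0 := by
  have h := congrArg (eval x) (rodD_rec k k)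
  simp at h
  linear_combination -h

open Polynomial in
lemma legendreP_eq (k : ℕ) (x : ℝ) :
    legendreP k x = (1 / (2 ^ k * (Nat.factorial k))) * (rodD k k).eval x := by
  unfold legendreP rodD rodF
  congr 1
  have h : (fun t : ℝ => (t ^ 2 - 1) ^ k) = fun t => ((X ^ 2 - 1 : ℝ[X]) ^ k).eval t := by
    funext t; simp
  rw [h, iteratedDeriv_eq_iterate]
  generalize ((X ^ 2 - 1 : ℝ[X]) ^ k) = p
  generalize hk : k = j
  clear hk h
  suffices deriv^[j] (fun t => p.eval t) = fun t => (derivative^[j] p).eval t from congrFun this x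
  induction j generalizing p with
  | zero => rfl
  | succ j ih =>
    rw [Function.iterate_succ_apply, Function.iterate_succ_apply]
    have : deriv (fun t => p.eval t) = fun t => (derivative p).eval t := by
      funext t; exact p.deriv
    rw [this, ih]

open Polynomial in
lemma rodF_dvd (k : ℕ) (a : ℝ) (ha : a ^ 2 = 1) : rodF k = (X - C a) ^ k * (X + C a) ^ k := by
  unfold rodF
  rw [← mul_pow]
  congr 1
  have : (C a : ℝ[X]) ^ 2 = 1 := by rw [← C_pow, ha, C_1]
  linear_combination this

open Polynomial in
lemma rodD_eval_one (k j : ℕ) (hj : j < k) (a : ℝ) (ha : a ^ 2 = 1) : (rodD k j).eval a = 0 := by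
  have h : (X - C a) ^ (k - j) ∣ rodD k j := by
    unfold rodD
    apply pow_sub_dvd_iterate_derivative_of_pow_dvd
    rw [rodF_dvd k a ha]; exact dvd_mul_right _ _
  have h2 : (X - C a) ∣ rodD k j := dvd_trans (dvd_pow_self _ (by omega)) h
  exact dvd_iff_isRoot.mp h2

open Polynomial in
lemma iter_deriv_pow_mul (k : ℕ) (a : ℝ) (g : ℝ[X]) :
    (derivative^[k] ((X - C a) ^ k * g)).eval a = k.factorial * g.eval a := by
  induction k generalizing g with
  | zero => simp
  | succ k ih =>
    rw [Function.iterate_succ_apply]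
    have : derivative ((X - C a) ^ (k + 1) * g) =
        (X - C a) ^ k * (((k : ℝ[X]) + 1) * g + (X - C a) * derivative g) := by
      simp only [derivative_mul, derivative_pow, derivative_sub, derivative_X, derivative_C, Nat.add_sub_cancel]
      simp
      ring
    rw [this, ih]
    simp [Nat.factorial_succ]
    ring

open Polynomial in
lemma rodD_eval_end (k : ℕ) (a : ℝ) (ha : a ^ 2 = 1) : ((rodD k k).eval a) ^ 2 = (2 ^ k * k.factorial) ^ 2 := by
  unfold rodD
  rw [rodF_dvd k a ha, iter_deriv_pow_mul]
  simp
  have : (a + a) ^ 2 = 2 ^ 2 := by linear_combination 4 * ha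
  rw [mul_pow, mul_pow, ← pow_mul, mul_comm k 2, pow_mul, this, ← pow_mul, ← pow_mul, mul_comm 2 k]
  ring

open Polynomial in
lemma rodD_orth (k i : ℕ) (hi : i ≤ k) (q : ℝ[X]) (hq : q.degree < i) :
    ∫ x in (-1:ℝ)..1, (rodD k i).eval x * q.eval x = 0 := by
  induction i generalizing q with
  | zero =>
    have : q = 0 := by
      rw [← degree_eq_bot]
      exact Nat.WithBot.lt_zero_iff.mp (by simpa using hq)
    simp [this]
  | succ i ih =>
    have h1 : ∀ x ∈ Set.uIcc (-1:ℝ) 1, HasDerivAt (fun x => (rodD k i).eval x) ((rodD k (i+1)).eval x) x := by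
      intro x _
      rw [← rodD_succ]; exact (rodD k i).hasDerivAt x
    have h2 : ∀ x ∈ Set.uIcc (-1:ℝ) 1, HasDerivAt (fun x => q.eval x) ((derivative q).eval x) x := by
      intro x _
      exact q.hasDerivAt x
    have := intervalIntegral.integral_deriv_mul_eq_sub h1 h2
      ((Polynomial.continuous _).intervalIntegrable _ _) ((Polynomial.continuous _).intervalIntegrable _ _)
    rw [intervalIntegral.integral_add] at this
    · rw [rodD_eval_one k i (by omega) 1 (by norm_num), rodD_eval_one k i (by omega) (-1) (by norm_num)] at this
      rw [ih (by omega) (derivative q)] at this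
      · simpa using this
      · by_cases h0 : q = 0
        · simp [h0]
        · refine lt_of_lt_of_le (degree_derivative_lt h0) ?_
          rw [degree_eq_natDegree h0] at hq ⊢
          norm_cast at hq ⊢
          omega
    · exact ((Polynomial.continuous _).mul (Polynomial.continuous _)).intervalIntegrable _ _
    · exact ((Polynomial.continuous _).mul (Polynomial.continuous _)).intervalIntegrable _ _

open Polynomial in
lemma rodF_natDegree (k : ℕ) : (rodF k).natDegree ≤ 2 * k := by
  unfold rodF
  refine (natDegree_pow_le).trans ?_
  have : (X ^ 2 - 1 : ℝ[X]).natDegree = 2 := by compute_degree!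
  rw [this]; omega

open Polynomial in
lemma rodD_natDegree (k : ℕ) : (rodD k k).natDegree ≤ k := by
  have := natDegree_iterate_derivative (rodF k) k
  have := rodF_natDegree k
  unfold rodD
  omega

open Polynomial in
lemma rodD_orth_ne (j k : ℕ) (h : j < k) :
    ∫ x in (-1:ℝ)..1, (rodD k k).eval x * (rodD j j).eval x = 0 := by
  apply rodD_orth k k le_rfl
  refine lt_of_le_of_lt degree_le_natDegree ?_
  have := rodD_natDegree j
  norm_cast; omega

open Polynomial in
lemma rodD_norm (k : ℕ) : (2 * (k:ℝ) + 1) * ∫ x in (-1:ℝ)..1, (rodD k k).eval x ^ 2 = 2 * (2 ^ k * k.factorial) ^ 2 := by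
  set p := rodD k k with hp
  have hlow : (X * derivative p - C (k : ℝ) * p).degree < ((k : ℕ) : WithBot ℕ) := by
    rw [degree_lt_iff_coeff_zero]
    intro i hi
    rcases Nat.lt_or_ge k i with h | h
    · have h1 : p.coeff i = 0 := coeff_eq_zero_of_natDegree_lt (lt_of_le_of_lt (rodD_natDegree k) h)
      obtain ⟨i', rfl⟩ : ∃ i', i = i' + 1 := ⟨i - 1, by omega⟩
      simp [coeff_X_mul, coeff_derivative, h1]
    · have : i = k := le_antisymm h hi
      subst this
      cases i with
      | zero => simp
      | succ i => 
        simp only [coeff_sub, coeff_X_mul, coeff_derivative, coeff_C_mul]; push_cast; ring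
  have h0 := rodD_orth k k le_rfl _ hlow
  rw [← hp] at h0
  have h1 : ∀ x ∈ Set.uIcc (-1:ℝ) 1, HasDerivAt (fun x => x * p.eval x ^ 2)
      ((2 * k + 1) * p.eval x ^ 2 + 2 * (p.eval x * (X * derivative p - C (k : ℝ) * p).eval x)) x := by
    intro x _
    have := (hasDerivAt_id x).mul ((p.hasDerivAt x).pow 2)
    refine this.congr_deriv ?_
    simp
    ring
  have := intervalIntegral.integral_eq_sub_of_hasDerivAt h1 (by
    apply Continuous.intervalIntegrable
    fun_prop)
  rw [intervalIntegral.integral_add, intervalIntegral.integral_const_mul, intervalIntegral.integral_const_mul, h0] at this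
  · have e1 := rodD_eval_end k 1 (by norm_num)
    have e2 := rodD_eval_end k (-1) (by norm_num)
    rw [← hp] at e1 e2
    rw [e1, e2] at this
    linarith
  · apply Continuous.intervalIntegrable; fun_prop
  · apply Continuous.intervalIntegrable; fun_prop

lemma cb_bound (l : ℕ) : ((l.centralBinom : ℝ)) ^ 2 * (2 * l + 1) ≤ (4 ^ l) ^ 2 := by
  induction l with
  | zero => simp
  | succ l ih =>
    have h := Nat.succ_mul_centralBinom_succ l
    have h' : ((l : ℝ) + 1) * ((l + 1).centralBinom : ℝ) = 2 * (2 * l + 1) * l.centralBinom := by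
      exact_mod_cast h
    have hl : (0:ℝ) ≤ l := Nat.cast_nonneg l
    have hp : (0:ℝ) < ((l:ℝ) + 1) ^ 2 := by positivity
    refine le_of_mul_le_mul_left ?_ hp
    push_cast
    calc ((l:ℝ) + 1) ^ 2 * (((l + 1).centralBinom : ℝ) ^ 2 * (2 * (l + 1) + 1))
        = (((l : ℝ) + 1) * ((l + 1).centralBinom : ℝ)) ^ 2 * (2 * l + 3) := by ring
      _ = 4 * (2 * l + 1) * (2 * l + 3) * ((l.centralBinom : ℝ) ^ 2 * (2 * l + 1)) := by rw [h']; ring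
      _ ≤ 4 * (2 * l + 1) * (2 * l + 3) * (4 ^ l) ^ 2 := by gcongr
      _ ≤ (16 * ((l:ℝ) + 1) ^ 2) * (4 ^ l) ^ 2 := by
          refine mul_le_mul_of_nonneg_right ?_ (by positivity)
          nlinarith
      _ = _ := by ring

open Polynomial in
lemma rodF_coeff (k j : ℕ) : (rodF k).coeff j =
    if 2 ∣ j then (-1) ^ (k - j / 2) * (k.choose (j / 2) : ℝ) else 0 := by
  have : rodF k = expand ℝ 2 ((X + C (-1)) ^ k) := by
    unfold rodF; simp [sub_eq_add_neg]
  rw [this, coeff_expand (by norm_num), coeff_X_add_C_pow]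

open Polynomial in
lemma rodD_eval_zero (k j : ℕ) : (rodD k j).eval 0 = j.factorial * (rodF k).coeff j := by
  unfold rodD
  rw [← coeff_zero_eq_eval_zero, coeff_iterate_derivative]
  simp [Nat.descFactorial_self]

open Polynomial in
lemma rod_zero_bound (k : ℕ) : ((rodD k k).eval 0) ^ 2 + ((rodD k (k + 1)).eval 0) ^ 2 / (((k : ℝ) + 1 / 2) ^ 2 + 1 / 4)
    ≤ (2 ^ k * k.factorial) ^ 2 / ((k : ℝ) + 1 / 2) := by
  rw [rodD_eval_zero, rodD_eval_zero, rodF_coeff, rodF_coeff]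
  rcases Nat.even_or_odd' k with ⟨l, rfl | rfl⟩
  · have h1 : 2 ∣ 2 * l := ⟨l, rfl⟩
    have h2 : ¬ (2 ∣ 2 * l + 1) := by omega
    rw [if_pos h1, if_neg h2]
    have h3 : 2 * l / 2 = l := by omega
    have h4 : 2 * l - l = l := by omega
    rw [h3, h4]
    have hcb := cb_bound l
    rw [Nat.centralBinom] at hcb
    have hs : ((-1 : ℝ) ^ l) ^ 2 = 1 := by rw [← pow_mul, mul_comm, pow_mul]; norm_num
    have hl : (0:ℝ) ≤ l := Nat.cast_nonneg l
    rw [mul_pow, mul_pow, hs, mul_pow, pow_mul]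
    norm_num
    rw [le_div_iff₀ (by positivity)]
    have : (0:ℝ) ≤ ((2 * l).factorial : ℝ) ^ 2 := by positivity
    have h5 : (0:ℝ) ≤ ((2 * l).choose l : ℝ) ^ 2 := by positivity
    nlinarith
  · have h1 : ¬ (2 ∣ 2 * l + 1) := by omega
    have h2 : (2 ∣ 2 * l + 1 + 1) := by omega
    rw [if_pos h2, if_neg h1]
    have h3 : (2 * l + 1 + 1) / 2 = l + 1 := by omega
    have h4 : 2 * l + 1 - (l + 1) = l := by omega
    rw [h3, h4]
    have hcb := cb_bound l
    rw [Nat.centralBinom] at hcb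
    have hch := Nat.add_one_mul_choose_eq (2 * l) l
    have hch' : (2 * (l:ℝ) + 1) * ((2 * l).choose l : ℝ) = ((2 * l + 1).choose (l + 1) : ℝ) * (l + 1) := by
      exact_mod_cast hch
    have hs : ((-1 : ℝ) ^ l) ^ 2 = 1 := by rw [← pow_mul, mul_comm, pow_mul]; norm_num
    have hl : (0:ℝ) ≤ l := Nat.cast_nonneg l
    have hf : ((2 * l + 1 + 1).factorial : ℝ) = (2 * l + 2) * (2 * l + 1).factorial := by
      rw [Nat.factorial_succ (2 * l + 1)]; push_cast; ring
    rw [hf, mul_pow _ (_ * _), mul_pow ((-1) ^ l), hs]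
    push_cast
    have e1 : ((2 * (l:ℝ) + 2) * (2 * l + 1).factorial) ^ 2 * (1 * ((2 * l + 1).choose (l + 1) : ℝ) ^ 2)
       = 4 * (2 * l + 1) * ((2 * l + 1).factorial : ℝ) ^ 2 * (((2 * l).choose l : ℝ) ^ 2 * (2 * l + 1)) := by
      have := congrArg (fun t => t ^ 2) hch'
      linear_combination (-4 * ((2 * l + 1).factorial : ℝ) ^ 2) * this
    rw [e1]
    have e2 : (2:ℝ) ^ (2 * l + 1) = 2 * 4 ^ l := by rw [pow_succ, pow_mul]; norm_num; ring
    rw [e2]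
    calc _ ≤ 4 * (2 * l + 1) * ((2 * l + 1).factorial : ℝ) ^ 2 * (4 ^ l) ^ 2 / ((2 * (l:ℝ) + 1 + 1 / 2) ^ 2 + 1 / 4) := by
            rw [mul_zero, zero_pow (by norm_num), zero_add]; gcongr
      _ ≤ _ := by
        rw [div_le_div_iff₀ (by positivity) (by positivity)]
        have : (0:ℝ) ≤ 4 * ((2 * l + 1).factorial : ℝ) ^ 2 * (4 ^ l) ^ 2 := by positivity
        have h6 : (2 * (l:ℝ) + 1) * (2 * l + 1 + 1 / 2) ≤ ((2 * (l:ℝ) + 1 + 1 / 2) ^ 2 + 1 / 4) := by nlinarith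
        nlinarith [mul_le_mul_of_nonneg_left h6 this]

/-- Sonine function. -/
noncomputable def sonine (k : ℕ) (x : ℝ) : ℝ :=
  Real.sqrt (1 - x ^ 2) * ((rodD k k).eval x ^ 2 +
    ((1 - x ^ 2) * (rodD k (k + 1)).eval x - x * (rodD k k).eval x / 2) ^ 2 /
      (((k : ℝ) + 1 / 2) ^ 2 * (1 - x ^ 2) + 1 / 4))

open Polynomial in
lemma sonine_deriv (k : ℕ) (x : ℝ) (hx : x ^ 2 < 1) :
    HasDerivAt (sonine k) (- x * (((1 - x ^ 2) * (rodD k (k + 1)).eval x - x * (rodD k k).eval x / 2) ^ 2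
      / (2 * Real.sqrt (1 - x ^ 2) * (((k : ℝ) + 1 / 2) ^ 2 * (1 - x ^ 2) + 1 / 4) ^ 2))) x := by
  have hy : 0 < 1 - x ^ 2 := by linarith
  have hode := rodD_ode k x
  have hP := (rodD k k).hasDerivAt x
  have hQ := (rodD k (k + 1)).hasDerivAt x
  rw [rodD_succ] at hP hQ
  have hyd : HasDerivAt (fun x : ℝ => 1 - x ^ 2) (-(2 * x)) x := by
    have := ((hasDerivAt_id x).pow 2).const_sub 1
    refine this.congr_deriv ?_
    simp
  have hsq := hyd.sqrt hy.ne'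
  have hq := (hyd.mul hQ).sub (((hasDerivAt_id x).mul hP).div_const 2)
  have hD := (hyd.const_mul (((k : ℝ) + 1 / 2) ^ 2)).add_const (1 / 4)
  have hDpos : 0 < ((k : ℝ) + 1 / 2) ^ 2 * (1 - x ^ 2) + 1 / 4 := by positivity
  have hfin := hsq.mul ((hP.pow 2).add ((hq.pow 2).div hD hDpos.ne'))
  refine hfin.congr_deriv ?_
  clear hfin hD hq hsq hyd hP hQ
  simp only [id, Pi.mul_apply, Pi.add_apply, Pi.sub_apply, Pi.pow_apply, Pi.div_apply]
  have hw : 0 < Real.sqrt (1 - x ^ 2) := Real.sqrt_pos.mpr hy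
  have hw2 : Real.sqrt (1 - x ^ 2) ^ 2 = 1 - x ^ 2 := Real.sq_sqrt hy.le
  generalize Real.sqrt (1 - x ^ 2) = w at *
  have hk : (rodD k (k + 1 + 1)).eval x = (2 * x * (rodD k (k + 1)).eval x
    - k * (k + 1) * (rodD k k).eval x) / w ^ 2 := by
    rw [hw2, eq_div_iff hy.ne']; linear_combination hode
  rw [hk]
  generalize (rodD k (k + 1)).eval x = q
  generalize (rodD k k).eval x = p
  rw [← hw2] at hDpos ⊢
  have hx2 : x ^ 2 = 1 - w ^ 2 := by linarith
  field_simp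
  clear hode hk
  generalize (k : ℝ) = K at *
  simp only [hw2]
  norm_num
  ring


open Polynomial in
lemma sonine_zero (k : ℕ) : sonine k 0 ≤ (2 ^ k * k.factorial) ^ 2 / ((k : ℝ) + 1 / 2) := by
  have := rod_zero_bound k
  unfold sonine
  simpa using this

lemma sonine_le (k : ℕ) (x : ℝ) (hx : x ^ 2 < 1) : sonine k x ≤ sonine k 0 := by
  have hcont : ∀ a : ℝ, a ^ 2 < 1 → ContinuousAt (sonine k) a := fun a ha => (sonine_deriv k a ha).continuousAt
  rcases le_total 0 x with h | h
  · have : AntitoneOn (sonine k) (Set.Icc 0 x) := by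
      apply antitoneOn_of_deriv_nonpos (convex_Icc 0 x)
      · intro a ha
        exact (hcont a (by nlinarith [ha.1, ha.2])).continuousWithinAt
      · intro a ha
        rw [interior_Icc] at ha
        exact (sonine_deriv k a (by nlinarith [ha.1, ha.2])).differentiableAt.differentiableWithinAt
      · intro a ha
        rw [interior_Icc] at ha
        rw [(sonine_deriv k a (by nlinarith [ha.1, ha.2])).deriv]
        have : a ^ 2 < 1 := by nlinarith [ha.1, ha.2]
        rw [neg_mul]
        apply neg_nonpos_of_nonneg
        apply mul_nonneg ha.1.le
        positivity
    exact this ⟨le_rfl, h⟩ ⟨h, le_rfl⟩ h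
  · have : MonotoneOn (sonine k) (Set.Icc x 0) := by
      apply monotoneOn_of_deriv_nonneg (convex_Icc x 0)
      · intro a ha
        exact (hcont a (by nlinarith [ha.1, ha.2])).continuousWithinAt
      · intro a ha
        rw [interior_Icc] at ha
        exact (sonine_deriv k a (by nlinarith [ha.1, ha.2])).differentiableAt.differentiableWithinAt
      · intro a ha
        rw [interior_Icc] at ha
        rw [(sonine_deriv k a (by nlinarith [ha.1, ha.2])).deriv]
        apply mul_nonneg (by linarith [ha.2])
        positivity
    exact this ⟨le_rfl, h⟩ ⟨h, le_rfl⟩ h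

lemma legendreL_bound (k : ℕ) (x : ℝ) (hx : x ^ 2 < 1) :
    Real.sqrt (1 - x ^ 2) * legendreL k x ^ 2 ≤ 1 := by
  have h1 := (sonine_le k x hx).trans (sonine_zero k)
  have hy : 0 < 1 - x ^ 2 := by linarith
  have h2 : Real.sqrt (1 - x ^ 2) * ((rodD k k).eval x ^ 2) ≤ sonine k x := by
    unfold sonine
    gcongr
    have : 0 ≤ ((1 - x ^ 2) * (rodD k (k + 1)).eval x - x * (rodD k k).eval x / 2) ^ 2 /
      (((k : ℝ) + 1 / 2) ^ 2 * (1 - x ^ 2) + 1 / 4) := by positivity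
    linarith
  have h3 := h2.trans h1
  have hF : (0:ℝ) < 2 ^ k * k.factorial := by positivity
  unfold legendreL
  rw [legendreP_eq, mul_pow, Real.sq_sqrt (by positivity), mul_pow, div_pow, one_pow]
  rw [le_div_iff₀ (by positivity)] at h3
  rw [show Real.sqrt (1 - x ^ 2) * (((k:ℝ) + 1 / 2) * (1 / (2 ^ k * (k.factorial:ℝ)) ^ 2 * (rodD k k).eval x ^ 2))
    = (Real.sqrt (1 - x ^ 2) * (rodD k k).eval x ^ 2 * ((k:ℝ) + 1 / 2)) / (2 ^ k * (k.factorial:ℝ)) ^ 2 by ring]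
  rw [div_le_one (by positivity)]
  exact h3

lemma legendreL_continuous (k : ℕ) : Continuous (legendreL k) := by
  have : legendreL k = fun x => Real.sqrt (k + 1 / 2) * ((1 / (2 ^ k * (Nat.factorial k))) * (rodD k k).eval x) := by
    funext x; unfold legendreL; rw [legendreP_eq]
  rw [this]; fun_prop

lemma legendreL_orth (j k : ℕ) : ∫ x in (-1:ℝ)..1, legendreL j x * legendreL k x = if j = k then 1 else 0 := by
  have e : ∀ j k : ℕ, ∫ x in (-1:ℝ)..1, legendreL j x * legendreL k x =
      (Real.sqrt (j + 1 / 2) * (1 / (2 ^ j * (Nat.factorial j))) * (Real.sqrt (k + 1 / 2) * (1 / (2 ^ k * (Nat.factorial k)))))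
        * ∫ x in (-1:ℝ)..1, (rodD j j).eval x * (rodD k k).eval x := by
    intro j k
    rw [← intervalIntegral.integral_const_mul]
    congr 1; funext x
    unfold legendreL; rw [legendreP_eq, legendreP_eq]; ring
  rw [e]
  split_ifs with h
  · subst h
    have := rodD_norm j
    have hF : (0:ℝ) < 2 ^ j * j.factorial := by positivity
    have h2 : ∫ x in (-1:ℝ)..1, (rodD j j).eval x * (rodD j j).eval x = ∫ x in (-1:ℝ)..1, (rodD j j).eval x ^ 2 := by
      congr 1; funext x; ring
    rw [h2]
    have h3 : Real.sqrt ((j:ℝ) + 1 / 2) ^ 2 = j + 1 / 2 := Real.sq_sqrt (by positivity)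
    rw [show ∀ a b I : ℝ, a * (1 / b) * (a * (1 / b)) * I = a ^ 2 * I / b ^ 2 by intros; ring, h3]
    rw [div_eq_one_iff_eq (by positivity)]
    linarith
  · rcases lt_or_gt_of_ne h with h | h
    · have := rodD_orth_ne j k h
      simp_rw [mul_comm (Polynomial.eval _ (rodD j j))]
      rw [this, mul_zero]
    · rw [rodD_orth_ne k j h, mul_zero]

lemma cheb_density_eq (x : ℝ) (hx : x ∈ Set.Ioo (-1:ℝ) 1) :
    Real.pi⁻¹ * (1 - x ^ 2) ^ (-(1 : ℝ) / 2) = Real.pi⁻¹ * Real.sqrt (1 - x ^ 2)⁻¹ := by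
  have hy : 0 < 1 - x ^ 2 := by nlinarith [hx.1, hx.2]
  rw [Real.sqrt_inv, Real.sqrt_eq_rpow, ← Real.rpow_neg hy.le]
  norm_num

instance cheb_prob : IsProbabilityMeasure chebMeasure := by
  constructor
  unfold chebMeasure
  rw [withDensity_apply _ MeasurableSet.univ, Measure.restrict_univ]
  have hint : IntegrableOn (fun x : ℝ => Real.pi⁻¹ * Real.sqrt (1 - x ^ 2)⁻¹) (Set.Ioo (-1) 1) := by
    have := Polynomial.Chebyshev.intervalIntegrable_sqrt_one_sub_sq_inv
    rw [intervalIntegrable_iff_integrableOn_Ioo_of_le (by norm_num)] at this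
    exact this.const_mul _
  have h1 : ∫⁻ x in Set.Ioo (-1:ℝ) 1, ENNReal.ofReal (Real.pi⁻¹ * (1 - x ^ 2) ^ (-(1 : ℝ) / 2))
      = ∫⁻ x in Set.Ioo (-1:ℝ) 1, ENNReal.ofReal (Real.pi⁻¹ * Real.sqrt (1 - x ^ 2)⁻¹) := by
    apply setLIntegral_congr_fun measurableSet_Ioo
    intro x hx
    simp only [cheb_density_eq x hx]
  rw [h1, ← ofReal_integral_eq_lintegral_ofReal hint (Filter.Eventually.of_forall fun x => by positivity)]
  have h2 := Polynomial.Chebyshev.integral_measureT (fun _ => (1:ℝ))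
  rw [Polynomial.Chebyshev.integral_measureT_eq_integral_cos] at h2
  simp only [intervalIntegral.integral_const, one_mul, sub_zero, smul_eq_mul, mul_one] at h2
  rw [intervalIntegral.integral_of_le (by norm_num), integral_Ioc_eq_integral_Ioo] at h2
  rw [integral_const_mul, ← h2, inv_mul_cancel₀ Real.pi_ne_zero, ENNReal.ofReal_one]

lemma cheb_ae : ∀ᵐ x ∂chebMeasure, x ∈ Set.Ioo (-1:ℝ) 1 := by
  have : chebMeasure ≪ volume.restrict (Set.Ioo (-1 : ℝ) 1) := withDensity_absolutelyContinuous _ _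
  exact this.ae_le (ae_restrict_mem measurableSet_Ioo)

noncomputable def wfun (x : ℝ) : ℝ := Real.sqrt (Real.pi / 2) * (1 - x ^ 2) ^ ((1 : ℝ) / 4)

lemma wfun_sq (x : ℝ) (hx : x ∈ Set.Ioo (-1:ℝ) 1) : wfun x ^ 2 = Real.pi / 2 * Real.sqrt (1 - x ^ 2) := by
  have hy : 0 < 1 - x ^ 2 := by nlinarith [hx.1, hx.2]
  unfold wfun
  rw [mul_pow, Real.sq_sqrt (by positivity), ← Real.rpow_natCast, ← Real.rpow_mul hy.le, Real.sqrt_eq_rpow]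
  norm_num

noncomputable def psi (k : ℕ) (x : ℝ) : ℝ :=
  Set.indicator (Set.Ioo (-1:ℝ) 1) (fun x => wfun x * legendreL k x / 2) x

lemma psi_measurable (k : ℕ) : Measurable (psi k) := by
  unfold psi
  apply Measurable.indicator _ measurableSet_Ioo
  have := (legendreL_continuous k).measurable
  unfold wfun
  fun_prop

lemma psi_bound (k : ℕ) (x : ℝ) : |psi k x| ≤ 1 := by
  unfold psi
  by_cases hx : x ∈ Set.Ioo (-1:ℝ) 1
  · rw [Set.indicator_of_mem hx]
    have hy : x ^ 2 < 1 := by nlinarith [hx.1, hx.2]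
    have h1 := legendreL_bound k x hy
    have h2 := wfun_sq x hx
    rw [← sq_le_one_iff_abs_le_one, div_pow, mul_pow, h2]
    have := Real.pi_le_four
    have := Real.pi_pos
    nlinarith
  · rw [Set.indicator_of_notMem hx]; simp

lemma psi_norm (m : ℕ) (v : Fin m → ℝ) :
    ∫ x, (∑ k, v k * psi k x) ^ 2 ∂chebMeasure = (∑ k, v k ^ 2) / 8 := by
  unfold chebMeasure
  rw [integral_withDensity_eq_integral_toReal_smul (by fun_prop) (Filter.Eventually.of_forall fun x => ENNReal.ofReal_lt_top)]
  have h1 : ∫ x in Set.Ioo (-1:ℝ) 1, (ENNReal.ofReal (Real.pi⁻¹ * (1 - x ^ 2) ^ (-(1 : ℝ) / 2))).toReal • (∑ k, v k * psi k x) ^ 2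
     = ∫ x in Set.Ioo (-1:ℝ) 1, (1 / 8) * ∑ j, ∑ k, v j * v k * (legendreL j x * legendreL k x) := by
    apply setIntegral_congr_fun measurableSet_Ioo
    intro x hx
    have hy : 0 < 1 - x ^ 2 := by nlinarith [hx.1, hx.2]
    simp only
    rw [cheb_density_eq x hx, ENNReal.toReal_ofReal (by positivity), smul_eq_mul]
    have : ∑ k, v k * psi k x = wfun x / 2 * ∑ k, v k * legendreL k x := by
      rw [Finset.mul_sum]
      apply Finset.sum_congr rfl
      intro k _
      unfold psi
      rw [Set.indicator_of_mem hx]; ring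
    rw [this, mul_pow, div_pow, wfun_sq x hx, Real.sqrt_inv]
    have hs : 0 < Real.sqrt (1 - x ^ 2) := Real.sqrt_pos.mpr hy
    have : ∑ j, ∑ k, v j * v k * (legendreL j x * legendreL k x) = (∑ k, v k * legendreL k x) ^ 2 := by
      rw [sq, Finset.sum_mul_sum]
      apply Finset.sum_congr rfl; intro j _
      apply Finset.sum_congr rfl; intro k _
      ring
    rw [this]
    have := Real.pi_pos
    field_simp
    ring
  rw [h1, ← integral_Ioc_eq_integral_Ioo, ← intervalIntegral.integral_of_le (by norm_num),
    intervalIntegral.integral_const_mul]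
  have hc : ∀ j k : ℕ, Continuous fun x => legendreL j x * legendreL k x :=
    fun j k => (legendreL_continuous j).mul (legendreL_continuous k)
  rw [intervalIntegral.integral_finsetSum]
  · have : ∀ j : Fin m, ∫ x in (-1:ℝ)..1, ∑ k : Fin m, v j * v k * (legendreL j x * legendreL k x) = v j ^ 2 := by
      intro j
      rw [intervalIntegral.integral_finsetSum]
      · simp_rw [intervalIntegral.integral_const_mul, legendreL_orth]
        rw [Finset.sum_eq_single j]
        · simp; ring
        · intro b _ hb
          rw [if_neg]
          · simp
          · intro h; exact hb (Fin.ext h.symm)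
        · simp
      · intro k _
        exact ((hc j k).const_mul _).intervalIntegrable _ _
    simp_rw [this]
    ring
  · intro j _
    apply Continuous.intervalIntegrable
    apply continuous_finsetSum
    intro k _
    exact (hc j k).const_mul _

open ProbabilityTheory in
lemma hoeff {T : Type*} [MeasurableSpace T] (p : Measure T) [IsProbabilityMeasure p] (b : T → ℝ)
    (hb : Measurable b) (hb1 : ∀ k, |b k| ≤ 1) (l : ℕ) (hl : 0 < l) (t : ℝ) (ht : 0 ≤ t) :
    (Measure.pi (fun _ : Fin l => p)).real
      {κ : Fin l → T | t ≤ |(∑ j, b (κ j)) / l - ∫ k, b k ∂p|} ≤ 2 * Real.exp (-(l * t ^ 2 / 2)) := by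
  have hlr : (0:ℝ) < l := by exact_mod_cast hl
  set π := Measure.pi (fun _ : Fin l => p) with hπ
  set M := ∫ k, b k ∂p with hM
  have hsub : ∀ c : T → ℝ, Measurable c → (∀ k, |c k| ≤ 1) →
      π.real {κ : Fin l → T | l * t ≤ ∑ j, (c (κ j) - ∫ k, c k ∂p)} ≤ Real.exp (-(l * t ^ 2 / 2)) := by
    intro c hc hc1
    have hind : iIndepFun (fun (i : Fin l) (ω : Fin l → T) => c (ω i) - ∫ k, c k ∂p) π :=
      iIndepFun_pi (X := fun _ k => c k - ∫ k, c k ∂p) (fun i => (hc.sub_const _).aemeasurable)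
    have hsg : ∀ i ∈ (Finset.univ : Finset (Fin l)),
        HasSubgaussianMGF (fun (ω : Fin l → T) => c (ω i) - ∫ k, c k ∂p) 1 π := by
      intro i _
      have h := hasSubgaussianMGF_of_mem_Icc (μ := π) (X := fun ω : Fin l → T => c (ω i)) (a := -1) (b := 1)
        (hc.comp (measurable_pi_apply i)).aemeasurable
        (Filter.Eventually.of_forall fun ω => abs_le.mp (hc1 _))
      have e : ∫ ω : Fin l → T, c (ω i) ∂π = ∫ k, c k ∂p := by
        have mp := measurePreserving_eval (fun _ : Fin l => p) i
        rw [← mp.map_eq]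
        rw [integral_map mp.measurable.aemeasurable hc.aestronglyMeasurable]
      rw [e] at h
      convert h using 1
      ext
      norm_num
    have := HasSubgaussianMGF.measure_sum_ge_le_of_iIndepFun hind (s := Finset.univ) (c := fun _ => 1) hsg
      (ε := l * t) (by positivity)
    refine this.trans (le_of_eq ?_)
    congr 1
    simp
    field_simp
  have h1 := hsub b hb hb1
  have h2 := hsub (fun k => - b k) hb.neg (fun k => by simpa using hb1 k)
  have hss : {κ : Fin l → T | t ≤ |(∑ j, b (κ j)) / l - M|} ⊆
      {κ : Fin l → T | l * t ≤ ∑ j, (b (κ j) - ∫ k, b k ∂p)} ∪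
      {κ : Fin l → T | l * t ≤ ∑ j, (-b (κ j) - ∫ k, -b k ∂p)} := by
    intro κ hκ
    simp only [Set.mem_ofPred_eq, Set.mem_union] at hκ ⊢
    rw [integral_neg, ← hM]
    simp only [Finset.sum_sub_distrib, Finset.sum_neg_distrib, Finset.sum_const, Finset.card_univ, Fintype.card_fin, nsmul_eq_mul]
    have e : (∑ j, b (κ j)) = l * ((∑ j, b (κ j)) / l) := by field_simp
    rcases le_abs.mp hκ with h | h
    · left
      rw [e]; nlinarith
    · right
      rw [e]; nlinarith
  calc _ ≤ _ := measureReal_mono hss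
    _ ≤ _ := measureReal_union_le _ _
    _ ≤ _ := by linarith

noncomputable def netFn {m l : ℕ} (ψ : Fin m → ℝ → ℝ) (κ : Fin l → Fin m × Bool) (x : ℝ) : ℝ :=
  (∑ j, (if (κ j).2 then ψ (κ j).1 x else - ψ (κ j).1 x)) / l

lemma netFn_measurable {m l : ℕ} (ψ : Fin m → ℝ → ℝ) (hψ : ∀ k, Measurable (ψ k)) (κ : Fin l → Fin m × Bool) :
    Measurable (netFn ψ κ) := by
  unfold netFn
  apply Measurable.div_const
  apply Finset.measurable_sum
  intro j _
  by_cases h : (κ j).2 = true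
  · simp only [h, if_true]; exact hψ _
  · simp only [h]; exact (hψ _).neg

lemma maurey {m l : ℕ} (hl : 0 < l) (ψ : Fin m → ℝ → ℝ) (hψ : ∀ k, Measurable (ψ k))
    (hb : ∀ k x, |ψ k x| ≤ 1) (u : Fin m → ℝ) (hu : ∑ k, |u k| = 1) (P Q : Measure ℝ)
    [IsProbabilityMeasure P] [IsProbabilityMeasure Q] (t : ℝ) (ht : 0 ≤ t) :
    ∃ κ : Fin l → Fin m × Bool,
      P.real {x | t ≤ |netFn ψ κ x - ∑ k, u k * ψ k x|} ≤ 4 * Real.exp (-(l * t ^ 2 / 2)) ∧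
      Q.real {x | t ≤ |netFn ψ κ x - ∑ k, u k * ψ k x|} ≤ 4 * Real.exp (-(l * t ^ 2 / 2)) := by
  set p : Measure (Fin m) := ∑ k, ENNReal.ofReal |u k| • Measure.dirac k with hp
  have hpp : IsProbabilityMeasure p := by
    constructor
    simp only [hp, Measure.coe_finsetSum, Finset.sum_apply, Measure.smul_apply, measure_univ, smul_eq_mul, mul_one]
    rw [← ENNReal.ofReal_sum_of_nonneg (fun _ _ => abs_nonneg _), hu, ENNReal.ofReal_one]
  have hint : ∀ f : Fin m → ℝ, ∫ k, f k ∂p = ∑ k, |u k| * f k := by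
    intro f
    rw [hp, integral_finsetSum_measure]
    · apply Finset.sum_congr rfl
      intro k _
      rw [integral_smul_measure, integral_dirac, ENNReal.toReal_ofReal (abs_nonneg _), smul_eq_mul]
    · intro k _
      exact (integrable_dirac (by simp)).smul_measure ENNReal.ofReal_ne_top
  set sg : Fin m → Fin m × Bool := fun k => (k, decide (0 ≤ u k)) with hsg
  set b : ℝ → Fin m → ℝ := fun x k => if (sg k).2 then ψ k x else - ψ k x with hbdef
  have hmean : ∀ x, ∫ k, b x k ∂p = ∑ k, u k * ψ k x := by
    intro x
    rw [hint]
    apply Finset.sum_congr rfl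
    intro k _
    simp only [hbdef, hsg, decide_eq_true_eq]
    split_ifs with h
    · rw [abs_of_nonneg h]
    · rw [abs_of_neg (not_le.mp h)]; ring
  set π := Measure.pi (fun _ : Fin l => p) with hπ
  set E := Real.exp (-(l * t ^ 2 / 2)) with hE
  set μ := P + Q with hμ
  set S : Set ((Fin l → Fin m) × ℝ) := {z | t ≤ |netFn ψ (fun j => sg (z.1 j)) z.2 - ∑ k, u k * ψ k z.2|} with hS
  have hSm : MeasurableSet S := by
    refine measurableSet_le measurable_const ?_
    apply measurable_from_prod_countable_right
    intro κ
    have h1 := netFn_measurable ψ hψ (fun j => sg (κ j))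
    have h2 : Measurable fun x => ∑ k, u k * ψ k x :=
      Finset.measurable_sum _ fun k _ => (hψ k).const_mul _
    exact (h1.sub h2).norm
  have hbound : ∫⁻ κ, μ (Prod.mk κ ⁻¹' S) ∂π ≤ ENNReal.ofReal (4 * E) := by
    rw [← Measure.prod_apply hSm, Measure.prod_apply_symm hSm]
    have : ∀ x, π ((fun κ => (κ, x)) ⁻¹' S) ≤ ENNReal.ofReal (2 * E) := by
      intro x
      have h := hoeff p (b x) (measurable_of_countable _) (fun k => by
        simp only [hbdef]; split_ifs
        · exact hb k x
        · rw [abs_neg]; exact hb k x) l hl t ht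
      rw [hmean x] at h
      rw [← ENNReal.ofReal_toReal (measure_ne_top π ((fun κ => (κ, x)) ⁻¹' S))]
      exact ENNReal.ofReal_le_ofReal h
    calc _ ≤ ∫⁻ x, ENNReal.ofReal (2 * E) ∂μ := lintegral_mono this
      _ = ENNReal.ofReal (2 * E) * 2 := by
        rw [lintegral_const, hμ, Measure.add_apply, measure_univ, measure_univ]; norm_num
      _ = _ := by
        rw [show (2 : ENNReal) = ENNReal.ofReal 2 by simp, ← ENNReal.ofReal_mul (by positivity)]
        congr 1; ring
  obtain ⟨κ, hκ⟩ := exists_le_lintegral (μ := π) (f := fun κ => μ (Prod.mk κ ⁻¹' S)) (measurable_of_countable _).aemeasurable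
  have hfin := hκ.trans hbound
  refine ⟨fun j => sg (κ j), ?_, ?_⟩
  · refine ENNReal.toReal_le_of_le_ofReal (by positivity) (le_trans ?_ hfin)
    rw [hμ, Measure.add_apply]
    exact le_self_add
  · refine ENNReal.toReal_le_of_le_ofReal (by positivity) (le_trans ?_ hfin)
    rw [hμ, Measure.add_apply]
    exact le_add_self

lemma layer_upper (F : ℝ) (hF : |F| ≤ 1) (I : ℕ) :
    F ^ 2 ≤ 4 * ∑ i ∈ Finset.range (I + 1), (1 / 4 : ℝ) ^ i * (if (1 / 2 : ℝ) ^ i ≤ |F| then 1 else 0) + (1 / 4 : ℝ) ^ I := by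
  have e : ∀ i : ℕ, (1 / 4 : ℝ) ^ i = ((1 / 2 : ℝ) ^ i) ^ 2 := by
    intro i; rw [← pow_mul, mul_comm, pow_mul]; norm_num
  induction I with
  | zero =>
    have : F ^ 2 ≤ 1 := (sq_le_one_iff_abs_le_one F).mpr hF
    simp
    split_ifs <;> linarith
  | succ I ih =>
    by_cases h : (1 / 2 : ℝ) ^ (I + 1) ≤ |F|
    · rw [Finset.sum_range_succ, if_pos h]
      refine ih.trans ?_
      rw [pow_succ]
      have : (0:ℝ) < (1 / 4) ^ I := by positivity
      linarith
    · have h1 : F ^ 2 ≤ (1 / 4 : ℝ) ^ (I + 1) := by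
        rw [e, ← sq_abs]
        exact pow_le_pow_left₀ (abs_nonneg _) (not_le.mp h).le 2
      have h2 : 0 ≤ ∑ i ∈ Finset.range (I + 1 + 1), (1 / 4 : ℝ) ^ i * (if (1 / 2 : ℝ) ^ i ≤ |F| then 1 else 0) := by
        apply Finset.sum_nonneg; intro i _; split_ifs <;> positivity
      linarith

lemma geom_quarter (N : ℕ) : ∑ i ∈ Finset.range N, (1 / 4 : ℝ) ^ i ≤ 4 / 3 := by
  rw [geom_sum_eq (by norm_num)]
  have : (0:ℝ) < (1 / 4) ^ N := by positivity
  rw [div_le_iff_of_neg (by norm_num)]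
  linarith

lemma layer_lower (F : ℝ) (N : ℕ) :
    ∑ i ∈ Finset.range N, (1 / 4 : ℝ) ^ i * (if (1 / 2 : ℝ) ^ (i + 1) ≤ |F| then 1 else 0) ≤ 16 / 3 * F ^ 2 := by
  induction N generalizing F with
  | zero => simp; positivity
  | succ N ih =>
    by_cases h : (1 / 2 : ℝ) ≤ |F|
    · have h1 : ∑ i ∈ Finset.range (N + 1), (1 / 4 : ℝ) ^ i * (if (1 / 2 : ℝ) ^ (i + 1) ≤ |F| then 1 else 0)
          ≤ ∑ i ∈ Finset.range (N + 1), (1 / 4 : ℝ) ^ i := by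
        apply Finset.sum_le_sum; intro i _
        split_ifs
        · simp
        · simp
      have := geom_quarter (N + 1)
      have h2 : (1 / 4 : ℝ) ≤ F ^ 2 := by rw [← sq_abs]; nlinarith
      linarith
    · rw [Finset.sum_range_succ']
      simp only [zero_add, pow_one, pow_zero, if_neg h, mul_zero, add_zero]
      have := ih (2 * F)
      have e : ∀ i : ℕ, ((1 / 2 : ℝ) ^ (i + 1 + 1) ≤ |F|) ↔ ((1 / 2 : ℝ) ^ (i + 1) ≤ |2 * F|) := by
        intro i
        rw [abs_mul, abs_of_pos (by norm_num : (0:ℝ) < 2), pow_succ _ (i + 1)]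
        constructor <;> intro h <;> linarith
      simp_rw [e, pow_succ (1 / 4 : ℝ), mul_assoc, mul_comm (1 / 4 : ℝ)]
      simp_rw [← mul_assoc]
      rw [← Finset.sum_mul]
      nlinarith

lemma int_ite (P : Measure ℝ) [IsProbabilityMeasure P] (f : ℝ → ℝ) (hf : Measurable f) (c : ℝ) :
    Integrable (fun x => if c ≤ |f x| then (1:ℝ) else 0) P ∧
    ∫ x, (if c ≤ |f x| then (1:ℝ) else 0) ∂P = P.real {x | c ≤ |f x|} := by
  have hm : MeasurableSet {x | c ≤ |f x|} := measurableSet_le measurable_const hf.norm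
  have e : (fun x => if c ≤ |f x| then (1:ℝ) else 0) = Set.indicator {x | c ≤ |f x|} 1 := by
    funext x; simp [Set.indicator]
  rw [e]
  exact ⟨(integrable_indicator_iff hm).mpr (integrable_const _).integrableOn, integral_indicator_one hm⟩

lemma compare_meas {m : ℕ} (ψ : Fin m → ℝ → ℝ) (hψ : ∀ k, Measurable (ψ k))
    (hb : ∀ k x, |ψ k x| ≤ 1) (u : Fin m → ℝ) (hu : ∑ k, |u k| = 1) (P Q : Measure ℝ)
    [IsProbabilityMeasure P] [IsProbabilityMeasure Q] (I : ℕ) (lv : ℕ → ℕ) (hlv : ∀ i, 0 < lv i)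
    (α : ℕ → ℝ) (β : ℝ) (hβ : ∀ i, 4 * Real.exp (-(lv i * (1 / 4 * (1 / 2 : ℝ) ^ i) ^ 2 / 2)) ≤ β)
    (hnet : ∀ i ∈ Finset.range (I + 1), ∀ κ : Fin (lv i) → Fin m × Bool,
      P.real {x | 3 / 4 * (1 / 2 : ℝ) ^ i ≤ |netFn ψ κ x|} / 2 - α i ≤
        Q.real {x | 3 / 4 * (1 / 2 : ℝ) ^ i ≤ |netFn ψ κ x|}) :
    ∫ x, (∑ k, u k * ψ k x) ^ 2 ∂P ≤ 128 / 3 * ∫ x, (∑ k, u k * ψ k x) ^ 2 ∂Q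
      + 8 * ∑ i ∈ Finset.range (I + 1), (1 / 4 : ℝ) ^ i * α i + 16 * β + (1 / 4 : ℝ) ^ I := by
  set F : ℝ → ℝ := fun x => ∑ k, u k * ψ k x with hF
  have hFm : Measurable F := Finset.measurable_sum _ fun k _ => (hψ k).const_mul _
  have hF1 : ∀ x, |F x| ≤ 1 := by
    intro x
    calc |F x| ≤ ∑ k, |u k * ψ k x| := Finset.abs_sum_le_sum_abs _ _
      _ ≤ ∑ k, |u k| := by
        apply Finset.sum_le_sum; intro k _
        rw [abs_mul]
        exact mul_le_of_le_one_right (abs_nonneg _) (hb k x)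
      _ = 1 := hu
  have hFint : ∀ R : Measure ℝ, IsProbabilityMeasure R → Integrable (fun x => F x ^ 2) R := by
    intro R _
    refine Integrable.of_bound (hFm.pow_const 2).aestronglyMeasurable 1 (Filter.Eventually.of_forall fun x => ?_)
    rw [Real.norm_eq_abs, abs_of_nonneg (sq_nonneg _)]
    exact (sq_le_one_iff_abs_le_one _).mpr (hF1 x)
  have hβ0 : 0 ≤ β := le_trans (by positivity) (hβ 0)
  -- upper
  have hup : ∫ x, F x ^ 2 ∂P ≤ 4 * ∑ i ∈ Finset.range (I + 1), (1 / 4 : ℝ) ^ i * P.real {x | (1 / 2 : ℝ) ^ i ≤ |F x|} + (1 / 4 : ℝ) ^ I := by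
    have hi : ∀ i ∈ Finset.range (I + 1), Integrable (fun x => (1 / 4 : ℝ) ^ i * (if (1 / 2 : ℝ) ^ i ≤ |F x| then 1 else 0)) P :=
      fun i _ => (int_ite P F hFm _).1.const_mul _
    calc ∫ x, F x ^ 2 ∂P ≤ ∫ x, (4 * ∑ i ∈ Finset.range (I + 1), (1 / 4 : ℝ) ^ i * (if (1 / 2 : ℝ) ^ i ≤ |F x| then 1 else 0) + (1 / 4 : ℝ) ^ I) ∂P := by
          apply integral_mono (hFint P inferInstance)
          · exact ((integrable_finsetSum _ hi).const_mul 4).add (integrable_const _)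
          · intro x; exact layer_upper (F x) (hF1 x) I
      _ = _ := by
          rw [integral_add ((integrable_finsetSum _ hi).const_mul 4) (integrable_const _), integral_const_mul,
            integral_finsetSum _ hi]
          simp_rw [integral_const_mul, (int_ite P F hFm _).2]
          simp
  have hlow : ∑ i ∈ Finset.range (I + 1), (1 / 4 : ℝ) ^ i * Q.real {x | (1 / 2 : ℝ) ^ (i + 1) ≤ |F x|} ≤ 16 / 3 * ∫ x, F x ^ 2 ∂Q := by
    have hi : ∀ i ∈ Finset.range (I + 1), Integrable (fun x => (1 / 4 : ℝ) ^ i * (if (1 / 2 : ℝ) ^ (i + 1) ≤ |F x| then 1 else 0)) Q :=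
      fun i _ => (int_ite Q F hFm _).1.const_mul _
    calc _ = ∫ x, (∑ i ∈ Finset.range (I + 1), (1 / 4 : ℝ) ^ i * (if (1 / 2 : ℝ) ^ (i + 1) ≤ |F x| then 1 else 0)) ∂Q := by
          rw [integral_finsetSum _ hi]
          simp_rw [integral_const_mul, (int_ite Q F hFm _).2]
      _ ≤ ∫ x, 16 / 3 * F x ^ 2 ∂Q := by
          apply integral_mono (integrable_finsetSum _ hi) ((hFint Q inferInstance).const_mul _)
          intro x; exact layer_lower (F x) (I + 1)
      _ = _ := by rw [integral_const_mul]
  have hlev : ∀ i ∈ Finset.range (I + 1), P.real {x | (1 / 2 : ℝ) ^ i ≤ |F x|} ≤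
      2 * Q.real {x | (1 / 2 : ℝ) ^ (i + 1) ≤ |F x|} + 2 * α i + 3 * β := by
    intro i hi
    obtain ⟨κ, h1, h2⟩ := maurey (hlv i) ψ hψ hb u hu P Q (1 / 4 * (1 / 2 : ℝ) ^ i) (by positivity)
    have h1' := h1.trans (hβ i)
    have h2' := h2.trans (hβ i)
    have h3 := hnet i hi κ
    have hp : (0:ℝ) < (1 / 2) ^ i := by positivity
    have s1 : {x | (1 / 2 : ℝ) ^ i ≤ |F x|} ⊆ {x | 3 / 4 * (1 / 2 : ℝ) ^ i ≤ |netFn ψ κ x|} ∪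
        {x | 1 / 4 * (1 / 2 : ℝ) ^ i ≤ |netFn ψ κ x - ∑ k, u k * ψ k x|} := by
      intro x hx
      by_contra hcon
      simp only [Set.mem_union, Set.mem_ofPred_eq, not_or, not_le] at hcon hx
      have : |F x| ≤ |netFn ψ κ x| + |netFn ψ κ x - F x| := by
        have := abs_sub_abs_le_abs_sub (F x) (netFn ψ κ x)
        rw [abs_sub_comm] at this; linarith
      have h5 := hcon.2
      change |netFn ψ κ x - F x| < _ at h5
      linarith [hcon.1]
    have s2 : {x | 3 / 4 * (1 / 2 : ℝ) ^ i ≤ |netFn ψ κ x|} ⊆ {x | (1 / 2 : ℝ) ^ (i + 1) ≤ |F x|} ∪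
        {x | 1 / 4 * (1 / 2 : ℝ) ^ i ≤ |netFn ψ κ x - ∑ k, u k * ψ k x|} := by
      intro x hx
      by_contra hcon
      simp only [Set.mem_union, Set.mem_ofPred_eq, not_or, not_le] at hcon hx
      have : |netFn ψ κ x| ≤ |F x| + |netFn ψ κ x - F x| := by
        have := abs_sub_abs_le_abs_sub (netFn ψ κ x) (F x)
        linarith
      have h5 := hcon.2
      change |netFn ψ κ x - F x| < _ at h5
      have h6 := hcon.1
      rw [pow_succ] at h6
      linarith
    have t1 := (measureReal_mono (μ := P) s1).trans (measureReal_union_le _ _)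
    have t2 := (measureReal_mono (μ := Q) s2).trans (measureReal_union_le _ _)
    linarith
  have hsum : ∑ i ∈ Finset.range (I + 1), (1 / 4 : ℝ) ^ i * P.real {x | (1 / 2 : ℝ) ^ i ≤ |F x|} ≤
      2 * ∑ i ∈ Finset.range (I + 1), (1 / 4 : ℝ) ^ i * Q.real {x | (1 / 2 : ℝ) ^ (i + 1) ≤ |F x|}
      + 2 * ∑ i ∈ Finset.range (I + 1), (1 / 4 : ℝ) ^ i * α i + 3 * β * ∑ i ∈ Finset.range (I + 1), (1 / 4 : ℝ) ^ i := by
    rw [Finset.mul_sum, Finset.mul_sum, Finset.mul_sum, ← Finset.sum_add_distrib, ← Finset.sum_add_distrib]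
    apply Finset.sum_le_sum
    intro i hi
    have := mul_le_mul_of_nonneg_left (hlev i hi) (by positivity : (0:ℝ) ≤ (1 / 4) ^ i)
    linarith
  have hg := mul_le_mul_of_nonneg_left (geom_quarter (I + 1)) hβ0
  linarith

noncomputable def emp (n : ℕ) (xs : Fin n → ℝ) : Measure ℝ := (n : ENNReal)⁻¹ • ∑ j, Measure.dirac (xs j)

lemma emp_prob (n : ℕ) (hn : 0 < n) (xs : Fin n → ℝ) : IsProbabilityMeasure (emp n xs) := by
  constructor
  simp only [emp, Measure.smul_apply, Measure.coe_finsetSum, Finset.sum_apply, measure_univ, smul_eq_mul]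
  simp
  exact ENNReal.inv_mul_cancel (by exact_mod_cast hn.ne') (ENNReal.natCast_ne_top n)

lemma emp_integral (n : ℕ) (xs : Fin n → ℝ) (f : ℝ → ℝ) : ∫ x, f x ∂(emp n xs) = (∑ j, f (xs j)) / n := by
  unfold emp
  rw [integral_smul_measure, integral_finsetSum_measure]
  · simp [integral_dirac]; ring
  · intro j _; exact integrable_dirac (by simp)

lemma chernoff (P : Measure ℝ) [IsProbabilityMeasure P] (n : ℕ) (hn : 0 < n) (A : Set ℝ) (hA : MeasurableSet A)
    (α : ℝ) (hα : 0 ≤ α) :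
    (Measure.pi (fun _ : Fin n => P)).real {xs | (emp n xs).real A < P.real A / 2 - α} ≤ Real.exp (-(n * α / 4)) := by
  set p := P.real A with hp
  have hnr : (0:ℝ) < n := by exact_mod_cast hn
  rcases le_or_gt (p / 2) α with h | h
  · have : {xs : Fin n → ℝ | (emp n xs).real A < p / 2 - α} = ∅ := by
      ext xs
      simp only [Set.mem_ofPred_eq, Set.mem_empty_iff_false, iff_false, not_lt]
      exact le_trans (by linarith) measureReal_nonneg
    rw [this]; simp; positivity
  · set f : ℝ → ℝ := fun x => Real.exp (- Set.indicator A 1 x) with hf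
    have hfm : Measurable f := Real.measurable_exp.comp ((measurable_one.indicator hA).neg)
    have hf1 : ∀ x, f x = 1 - (1 - Real.exp (-1)) * Set.indicator A 1 x := by
      intro x
      simp only [hf]
      by_cases hx : x ∈ A
      · simp [hx]
      · simp [hx]
    have hind : Integrable (Set.indicator A (1 : ℝ → ℝ)) P :=
      (integrable_indicator_iff hA).mpr (integrable_const _).integrableOn
    have hint : ∫ x, f x ∂P = 1 - (1 - Real.exp (-1)) * p := by
      rw [integral_congr_ae (Filter.Eventually.of_forall hf1)]
      rw [integral_sub (integrable_const _) (hind.const_mul _), integral_const_mul, integral_indicator_one hA]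
      simp [hp]
    have hfle : ∫ x, f x ∂P ≤ Real.exp (-((1 - Real.exp (-1)) * p)) := by
      rw [hint]
      have := Real.add_one_le_exp (-((1 - Real.exp (-1)) * p))
      linarith
    have hf0 : 0 ≤ ∫ x, f x ∂P := integral_nonneg fun x => (Real.exp_pos _).le
    have hprod := integral_fintype_prod_eq_pow (ι := Fin n) (𝕜 := ℝ) f (μ := P)
    rw [Fintype.card_fin] at hprod
    have hpm : Measurable fun xs : Fin n → ℝ => ∏ i, f (xs i) :=
      Finset.measurable_prod _ fun i _ => hfm.comp (measurable_pi_apply i)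
    have hnn : ∀ xs : Fin n → ℝ, 0 ≤ ∏ i, f (xs i) := fun xs => Finset.prod_nonneg fun i _ => (Real.exp_pos _).le
    have hprodint : Integrable (fun xs : Fin n → ℝ => ∏ i, f (xs i)) (Measure.pi (fun _ : Fin n => P)) := by
      refine Integrable.of_bound hpm.aestronglyMeasurable 1 (Filter.Eventually.of_forall fun xs => ?_)
      rw [Real.norm_eq_abs, abs_of_nonneg (hnn xs)]
      apply Finset.prod_le_one (fun i _ => (Real.exp_pos _).le)
      intro i _
      change Real.exp (-Set.indicator A 1 (xs i)) ≤ 1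
      rw [Real.exp_le_one_iff, neg_nonpos]
      exact Set.indicator_nonneg (fun _ _ => zero_le_one) _
    have hmk := mul_meas_ge_le_integral_of_nonneg (μ := Measure.pi (fun _ : Fin n => P))
      (Filter.Eventually.of_forall hnn) hprodint (Real.exp (-(n * p / 2)))
    rw [hprod] at hmk
    have hss : {xs : Fin n → ℝ | (emp n xs).real A < p / 2 - α} ⊆ {xs | Real.exp (-(n * p / 2)) ≤ ∏ i, f (xs i)} := by
      intro xs hxs
      simp only [Set.mem_ofPred_eq] at hxs ⊢
      simp only [hf]
      rw [← Real.exp_sum, Real.exp_le_exp, Finset.sum_neg_distrib, neg_le_neg_iff]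
      rw [← integral_indicator_one hA, emp_integral, div_lt_iff₀ hnr] at hxs
      nlinarith
    have h1 : (∫ x, f x ∂P) ^ n ≤ Real.exp (-((1 - Real.exp (-1)) * p)) ^ n := pow_le_pow_left₀ hf0 hfle n
    rw [← Real.exp_nat_mul] at h1
    have h2 := (mul_le_mul_of_nonneg_left (measureReal_mono (μ := Measure.pi (fun _ : Fin n => P)) hss) (Real.exp_pos (-(n * p / 2))).le).trans (hmk.trans h1)
    have h3 := mul_le_mul_of_nonneg_left h2 (Real.exp_pos (n * p / 2)).le
    rw [← mul_assoc, ← Real.exp_add, ← Real.exp_add, add_neg_cancel, Real.exp_zero, one_mul] at h3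
    refine h3.trans (Real.exp_le_exp.mpr ?_)
    have he : Real.exp (-1) ≤ 3 / 8 := by
      have := Real.exp_neg_one_lt_d9; linarith
    have hp0 : 0 ≤ p := measureReal_nonneg
    have : n * p * Real.exp (-1) ≤ n * p * (3 / 8) := by gcongr
    nlinarith

lemma log_s_facts (s : ℕ) (hs : 2 ≤ s) : (0.69:ℝ) ≤ Real.log s := by
  have h1 : Real.log 2 ≤ Real.log s := Real.log_le_log (by norm_num) (by exact_mod_cast hs)
  have := Real.log_two_gt_d9
  linarith

set_option maxHeartbeats 2000000 in
lemma bos (P : Measure ℝ) [IsProbabilityMeasure P] {m : ℕ} (ψ : Fin m → ℝ → ℝ) (hψ : ∀ k, Measurable (ψ k))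
    (hb : ∀ k x, |ψ k x| ≤ 1) (s n : ℕ) (hs : 2 ≤ s) (hm : 2 ≤ m)
    (hn : (2 ^ 32 : ℝ) * s * Real.log s ^ 3 * Real.log m ≤ n) :
    (Measure.pi (fun _ : Fin n => P)).real {xs | ¬ ∀ u : Fin m → ℝ, ∑ k, |u k| = 1 →
      ∫ x, (∑ k, u k * ψ k x) ^ 2 ∂P ≤ 43 * ((∑ j, (∑ k, u k * ψ k (xs j)) ^ 2) / n) + 3 / (1024 * s)}
      ≤ (m : ℝ) ^ (-(2 ^ 13 * Real.log s ^ 3)) := by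
  set L := Real.log s with hL
  set Λ := Real.log m with hΛ
  have hL1 : (0.69:ℝ) ≤ L := log_s_facts s hs
  have hΛ1 : (0.69:ℝ) ≤ Λ := log_s_facts m hm
  have hLp : 0 < L := by linarith
  have hΛp : 0 < Λ := by linarith
  have hsr : (2:ℝ) ≤ s := by exact_mod_cast hs
  have hsp : (0:ℝ) < s := by linarith
  have hmr : (2:ℝ) ≤ m := by exact_mod_cast hm
  have hnr : (0:ℝ) < n := lt_of_lt_of_le (by positivity) hn
  have hn0 : 0 < n := by exact_mod_cast hnr
  set I := Nat.log 2 s + 6 with hI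
  set lv : ℕ → ℕ := fun i => ⌈544 * 4 ^ i * L⌉₊ with hlvdef
  set α : ℕ → ℝ := fun i => (1 + 4 ^ i / L) / (2 ^ 17 * s) with hα
  set β : ℝ := 1 / (2 ^ 14 * s) with hβdef
  have hlv0 : ∀ i, 0 < lv i := fun i => Nat.ceil_pos.mpr (by positivity)
  have hβ : ∀ i, 4 * Real.exp (-(lv i * (1 / 4 * (1 / 2 : ℝ) ^ i) ^ 2 / 2)) ≤ β := by
    intro i
    have h1 : 544 * 4 ^ i * L ≤ lv i := Nat.le_ceil _
    have e : (1 / 4 * (1 / 2 : ℝ) ^ i) ^ 2 = 1 / (16 * 4 ^ i) := by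
      rw [mul_pow, ← pow_mul, mul_comm i 2, pow_mul]; norm_num
      rw [one_div_pow]; ring
    rw [e]
    have h4 : (0:ℝ) < 4 ^ i := by positivity
    have h2 : L + 16 * Real.log 2 ≤ lv i * (1 / (16 * 4 ^ i)) / 2 := by
      have : 17 * L ≤ lv i * (1 / (16 * 4 ^ i)) / 2 := by
        rw [show (lv i : ℝ) * (1 / (16 * 4 ^ i)) / 2 = lv i / (32 * 4 ^ i) by field_simp; ring, le_div_iff₀ (by positivity)]
        linarith
      have hl2 : Real.log 2 ≤ L := Real.log_le_log (by norm_num) hsr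
      linarith
    calc 4 * Real.exp (-(lv i * (1 / (16 * 4 ^ i)) / 2)) ≤ 4 * Real.exp (-(L + 16 * Real.log 2)) := by gcongr
      _ = β := by
        rw [Real.exp_neg, Real.exp_add, hL, Real.exp_log hsp, show (16:ℝ) * Real.log 2 = ((16:ℕ):ℝ) * Real.log 2 by norm_num,
          Real.exp_nat_mul, Real.exp_log (by norm_num), hβdef]
        field_simp; norm_num
  -- error
  have hI1 : ((I : ℝ) + 1) ≤ 12 * L := by
    have h1 : (2:ℝ) ^ (Nat.log 2 s) ≤ s := by exact_mod_cast Nat.pow_log_le_self 2 (by omega)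
    have h2 := Real.log_le_log (by positivity) h1
    rw [Real.log_pow] at h2
    have h3 := Real.log_two_gt_d9
    have h4 : (0:ℝ) ≤ (Nat.log 2 s : ℝ) := Nat.cast_nonneg _
    have h5 : (Nat.log 2 s : ℝ) * 0.6931 ≤ L := by nlinarith
    have h6 : Real.log 2 ≤ L := Real.log_le_log (by norm_num) hsr
    rw [hI]; push_cast; nlinarith
  have hI2 : (1 / 4 : ℝ) ^ I ≤ 1 / (1024 * s) := by
    have h1 : (s:ℝ) ≤ 2 ^ (Nat.log 2 s + 1) := by exact_mod_cast (Nat.lt_pow_succ_log_self (by norm_num) s).le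
    have e : (4:ℝ) ^ I = 1024 * (2 ^ (Nat.log 2 s + 1)) ^ 2 := by
      rw [hI, ← pow_mul, mul_comm _ 2, pow_mul]; norm_num; ring
    rw [one_div, inv_pow, ← one_div]
    apply one_div_le_one_div_of_le (by positivity)
    rw [e]
    nlinarith
  have herr : 8 * ∑ i ∈ Finset.range (I + 1), (1 / 4 : ℝ) ^ i * α i + 16 * β + (1 / 4 : ℝ) ^ I ≤ 3 / (1024 * s) := by
    have e : ∑ i ∈ Finset.range (I + 1), (1 / 4 : ℝ) ^ i * α i =
        (∑ i ∈ Finset.range (I + 1), (1 / 4 : ℝ) ^ i + ((I : ℝ) + 1) / L) / (2 ^ 17 * s) := by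
      have : ((I : ℝ) + 1) / L = ∑ i ∈ Finset.range (I + 1), 1 / L := by
        simp; field_simp
      rw [this, ← Finset.sum_add_distrib, Finset.sum_div]
      apply Finset.sum_congr rfl
      intro i _
      simp only [hα]
      rw [one_div, inv_pow]
      field_simp
    have hg := geom_quarter (I + 1)
    have h2 : ((I : ℝ) + 1) / L ≤ 12 := by rw [div_le_iff₀ hLp]; exact hI1
    have h3 : 8 * ∑ i ∈ Finset.range (I + 1), (1 / 4 : ℝ) ^ i * α i ≤ 1 / (1024 * s) := by
      rw [e]
      calc _ ≤ 8 * ((16:ℝ) / (2 ^ 17 * s)) := by gcongr; linarith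
        _ = _ := by field_simp; norm_num
    have h4 : 16 * β = 1 / (1024 * s) := by rw [hβdef]; field_simp; norm_num
    rw [h4]
    have : (3:ℝ) / (1024 * s) = 1 / (1024 * s) + 1 / (1024 * s) + 1 / (1024 * s) := by ring
    rw [this]
    linarith
  -- the bad event
  have hsub : {xs : Fin n → ℝ | ¬ ∀ u : Fin m → ℝ, ∑ k, |u k| = 1 →
      ∫ x, (∑ k, u k * ψ k x) ^ 2 ∂P ≤ 43 * ((∑ j, (∑ k, u k * ψ k (xs j)) ^ 2) / n) + 3 / (1024 * s)} ⊆
      ⋃ i ∈ Finset.range (I + 1), ⋃ κ : Fin (lv i) → Fin m × Bool,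
        {xs | (emp n xs).real {x | 3 / 4 * (1 / 2 : ℝ) ^ i ≤ |netFn ψ κ x|} <
          P.real {x | 3 / 4 * (1 / 2 : ℝ) ^ i ≤ |netFn ψ κ x|} / 2 - α i} := by
    intro xs hxs
    by_contra hcon
    apply hxs
    intro u hu
    have := emp_prob n hn0 xs
    have hc := compare_meas ψ hψ hb u hu P (emp n xs) I lv hlv0 α β hβ (by
      intro i hi κ
      by_contra h
      apply hcon
      simp only [Set.mem_iUnion]
      exact ⟨i, hi, κ, not_le.mp h⟩)
    rw [emp_integral] at hc
    have hnn : 0 ≤ (∑ j, (∑ k, u k * ψ k (xs j)) ^ 2) / (n:ℝ) := by positivity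
    linarith
  have hterm : ∀ i, ∀ κ : Fin (lv i) → Fin m × Bool,
      (Measure.pi (fun _ : Fin n => P)).real {xs | (emp n xs).real {x | 3 / 4 * (1 / 2 : ℝ) ^ i ≤ |netFn ψ κ x|} <
          P.real {x | 3 / 4 * (1 / 2 : ℝ) ^ i ≤ |netFn ψ κ x|} / 2 - α i} ≤ Real.exp (-(n * α i / 4)) := by
    intro i κ
    apply chernoff P n hn0 _ _ _ (by positivity)
    exact measurableSet_le measurable_const (netFn_measurable ψ hψ κ).norm
  have hlevel : ∀ i, ((Fintype.card (Fin (lv i) → Fin m × Bool) : ℕ) : ℝ) * Real.exp (-(n * α i / 4)) ≤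
      Real.exp (-(2 ^ 13 * L ^ 3 * Λ)) * ((3 / 4) * (1 / 4) ^ i) := by
    intro i
    have h4 : (1:ℝ) ≤ 4 ^ i := one_le_pow₀ (by norm_num)
    have hcard : ((Fintype.card (Fin (lv i) → Fin m × Bool) : ℕ) : ℝ) ≤ Real.exp (lv i * (2 * Λ)) := by
      simp only [Fintype.card_fun, Fintype.card_prod, Fintype.card_fin, Fintype.card_bool]
      push_cast
      rw [Real.exp_nat_mul]
      apply pow_le_pow_left₀ (by positivity)
      rw [two_mul, Real.exp_add, hΛ, Real.exp_log (by positivity)]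
      nlinarith
    have hlvu : (lv i : ℝ) ≤ 1000 * 4 ^ i * L := by
      have := (Nat.ceil_lt_add_one (by positivity : 0 ≤ 544 * 4 ^ i * L)).le
      have h5 : 0.69 ≤ 4 ^ i * L := by nlinarith
      simp only [hlvdef]
      nlinarith
    have hLL : L ≤ 1.5 * L ^ 2 := by nlinarith
    set Y := 4 ^ i * (L ^ 2 * Λ) with hY
    have hLΛ : 0.3 ≤ L ^ 2 * Λ := by
      have : (0.47:ℝ) ≤ L ^ 2 := by nlinarith
      nlinarith
    have hYl : 0.3 * 4 ^ i ≤ Y := by rw [hY]; nlinarith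
    have hA : lv i * (2 * Λ) ≤ 3000 * Y := by
      calc lv i * (2 * Λ) ≤ (1000 * 4 ^ i * L) * (2 * Λ) := by gcongr
        _ ≤ (1000 * 4 ^ i * (1.5 * L ^ 2)) * (2 * Λ) := by gcongr
        _ = 3000 * Y := by rw [hY]; ring
    have hB : 2 ^ 13 * L ^ 3 * Λ + 2 ^ 13 * Y ≤ n * α i / 4 := by
      calc 2 ^ 13 * L ^ 3 * Λ + 2 ^ 13 * Y = ((2 ^ 32 : ℝ) * s * L ^ 3 * Λ) * α i / 4 := by
            simp only [hα, hY]; field_simp; ring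
        _ ≤ n * α i / 4 := by
            have : 0 ≤ α i := by positivity
            gcongr
    calc _ ≤ Real.exp (lv i * (2 * Λ)) * Real.exp (-(n * α i / 4)) := mul_le_mul_of_nonneg_right hcard (Real.exp_pos _).le
      _ = Real.exp (lv i * (2 * Λ) + -(n * α i / 4)) := by rw [Real.exp_add]
      _ ≤ Real.exp (-(2 ^ 13 * L ^ 3 * Λ) + -(10 * 4 ^ i)) := by
          apply Real.exp_le_exp.mpr
          linarith
      _ = Real.exp (-(2 ^ 13 * L ^ 3 * Λ)) * Real.exp (-(10 * 4 ^ i)) := by rw [Real.exp_add]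
      _ ≤ _ := by
          gcongr
          rw [Real.exp_neg, one_div, inv_pow]
          have h6 := Real.add_one_le_exp ((10:ℝ) * 4 ^ i)
          rw [show (3 / 4 : ℝ) * (4 ^ i)⁻¹ = ((4 / 3) * 4 ^ i)⁻¹ by rw [mul_inv]; norm_num]
          apply inv_anti₀ (by positivity)
          linarith
  have hfinal : (Measure.pi (fun _ : Fin n => P)).real (⋃ i ∈ Finset.range (I + 1), ⋃ κ : Fin (lv i) → Fin m × Bool,
        {xs | (emp n xs).real {x | 3 / 4 * (1 / 2 : ℝ) ^ i ≤ |netFn ψ κ x|} <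
          P.real {x | 3 / 4 * (1 / 2 : ℝ) ^ i ≤ |netFn ψ κ x|} / 2 - α i}) ≤ Real.exp (-(2 ^ 13 * L ^ 3 * Λ)) := by
    calc _ ≤ ∑ i ∈ Finset.range (I + 1), (Measure.pi (fun _ : Fin n => P)).real (⋃ κ : Fin (lv i) → Fin m × Bool,
        {xs | (emp n xs).real {x | 3 / 4 * (1 / 2 : ℝ) ^ i ≤ |netFn ψ κ x|} <
          P.real {x | 3 / 4 * (1 / 2 : ℝ) ^ i ≤ |netFn ψ κ x|} / 2 - α i}) := measureReal_biUnion_finset_le _ _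
      _ ≤ ∑ i ∈ Finset.range (I + 1), Real.exp (-(2 ^ 13 * L ^ 3 * Λ)) * ((3 / 4) * (1 / 4) ^ i) := by
          apply Finset.sum_le_sum
          intro i _
          refine le_trans ?_ (hlevel i)
          refine (measureReal_iUnion_fintype_le _).trans ?_
          refine (Finset.sum_le_sum fun κ _ => hterm i κ).trans ?_
          rw [Finset.sum_const, nsmul_eq_mul, Finset.card_univ]
      _ ≤ _ := by
          rw [← Finset.mul_sum, ← Finset.mul_sum]
          have hg := geom_quarter (I + 1)
          apply mul_le_of_le_one_right (Real.exp_pos _).le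
          linarith
  refine (measureReal_mono hsub (measure_ne_top _ _)).trans (hfinal.trans (le_of_eq ?_))
  rw [Real.rpow_def_of_pos (by positivity)]
  congr 1
  rw [← hΛ]; ring


/-- Lower bound on a cone. -/
def ConeLB (s m n : ℕ) (xs : Fin n → ℝ) : Prop :=
  ∀ h : Fin m → ℝ, l1norm h ≤ 4 * (Real.sqrt s * l2norm h) →
    l2norm h ^ 2 * n ≤ 172 * ∑ j, (Wdiag n xs j * (legMatrix n m xs).mulVec h j) ^ 2

lemma l2norm_sq {m : ℕ} (h : Fin m → ℝ) : l2norm h ^ 2 = ∑ i, h i ^ 2 := by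
  unfold l2norm
  exact Real.sq_sqrt (Finset.sum_nonneg fun i _ => sq_nonneg _)

lemma cone_of_good (s m n : ℕ) (hs : 2 ≤ s) (hn : 0 < n) (xs : Fin n → ℝ) (hx : ∀ j, xs j ∈ Set.Ioo (-1:ℝ) 1)
    (hg : ∀ u : Fin m → ℝ, ∑ k, |u k| = 1 →
      ∫ x, (∑ k, u k * psi (k : ℕ) x) ^ 2 ∂chebMeasure ≤
        43 * ((∑ j, (∑ k, u k * psi (k : ℕ) (xs j)) ^ 2) / n) + 3 / (1024 * s)) :
    ConeLB s m n xs := by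
  intro h hh
  have hsr : (2:ℝ) ≤ s := by exact_mod_cast hs
  have hsp : (0:ℝ) < s := by linarith
  have hnr : (0:ℝ) < n := by exact_mod_cast hn
  have hN0 : 0 ≤ l1norm h := Finset.sum_nonneg fun i _ => abs_nonneg _
  have hR : ∀ j, Wdiag n xs j * (legMatrix n m xs).mulVec h j = 2 * ∑ k, h k * psi (k : ℕ) (xs j) := by
    intro j
    simp only [Matrix.mulVec, dotProduct, legMatrix, Matrix.of_apply, Finset.mul_sum]
    apply Finset.sum_congr rfl
    intro k _
    have : psi (k : ℕ) (xs j) = wfun (xs j) * legendreL k (xs j) / 2 := by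
      unfold psi; exact Set.indicator_of_mem (hx j) _
    rw [this, show Wdiag n xs j = wfun (xs j) from rfl]
    ring
  simp only [hR]
  set N := l1norm h with hN
  rcases hN0.eq_or_lt with h0 | hpos
  · have hz : ∀ i, h i = 0 := by
      intro i
      have := (Finset.sum_eq_zero_iff_of_nonneg (fun i _ => abs_nonneg (h i))).mp h0.symm i (Finset.mem_univ i)
      exact abs_eq_zero.mp this
    rw [l2norm_sq]
    simp [hz]
  · have hu : ∑ k, |h k / N| = 1 := by
      simp only [abs_div, abs_of_pos hpos]
      rw [← Finset.sum_div]
      exact div_self hpos.ne'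
    have h1 := hg (fun k => h k / N) hu
    rw [psi_norm] at h1
    have e1 : ∑ k, (h k / N) ^ 2 = l2norm h ^ 2 / N ^ 2 := by
      rw [l2norm_sq, Finset.sum_div]; simp only [div_pow]
    have e2 : ∑ j, (∑ k, h k / N * psi (k : ℕ) (xs j)) ^ 2 = (∑ j, (∑ k, h k * psi (k : ℕ) (xs j)) ^ 2) / N ^ 2 := by
      rw [Finset.sum_div]
      apply Finset.sum_congr rfl
      intro j _
      rw [← div_pow, Finset.sum_div]
      congr 1
      apply Finset.sum_congr rfl
      intro k _
      ring
    rw [e1, e2] at h1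
    have e3 : ∑ j, (2 * ∑ k, h k * psi (k : ℕ) (xs j)) ^ 2 = 4 * ∑ j, (∑ k, h k * psi (k : ℕ) (xs j)) ^ 2 := by
      rw [Finset.mul_sum]; apply Finset.sum_congr rfl; intro j _; ring
    rw [e3]
    set A := ∑ j, (∑ k, h k * psi (k : ℕ) (xs j)) ^ 2
    set B := l2norm h ^ 2 with hB
    have hc : N ^ 2 ≤ 16 * s * B := by
      have := pow_le_pow_left₀ hN0 hh 2
      rw [mul_pow, mul_pow, Real.sq_sqrt hsp.le] at this
      linarith
    have hN2 : 0 < N ^ 2 := by positivity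
    have h2 : B / 8 ≤ 43 * (A / n) + 3 / (1024 * s) * N ^ 2 := by
      have := mul_le_mul_of_nonneg_right h1 hN2.le
      have e4 : B / N ^ 2 / 8 * N ^ 2 = B / 8 := by field_simp
      have e5 : (43 * (A / N ^ 2 / n) + 3 / (1024 * s)) * N ^ 2 = 43 * (A / n) + 3 / (1024 * s) * N ^ 2 := by field_simp
      rw [e4, e5] at this
      exact this
    have h3 : 3 / (1024 * s) * N ^ 2 ≤ B * (3 / 64) := by
      calc 3 / (1024 * s) * N ^ 2 ≤ 3 / (1024 * s) * (16 * s * B) := by gcongr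
        _ = B * (3 / 64) := by field_simp; ring
    have h4 : B / 16 ≤ 43 * (A / n) := by
      have : 0 ≤ B := by positivity
      linarith
    have h5 := mul_le_mul_of_nonneg_right h4 hnr.le
    have e6 : 43 * (A / n) * n = 43 * A := by field_simp
    rw [e6] at h5
    linarith

lemma recovery_one (s m n : ℕ) (hs : 2 ≤ s) (hn : 0 < n) (xs : Fin n → ℝ) (hc : ConeLB s m n xs)
    (c z h : Fin m → ℝ) (ε : ℝ) (hε : 0 ≤ ε) (hz : IsSparse s z)
    (hl : l1norm (c + h) ≤ l1norm c)
    (ht : ∑ j, (Wdiag n xs j * (legMatrix n m xs).mulVec h j) ^ 2 ≤ 4 * (n * ε ^ 2)) :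
    l2norm h ≤ l1norm (c - z) / Real.sqrt s + 27 * ε ∧
    l1norm h ≤ 4 * l1norm (c - z) + 54 * Real.sqrt s * ε := by
  classical
  have hsr : (2:ℝ) ≤ s := by exact_mod_cast hs
  have hsp : (0:ℝ) < s := by linarith
  have hnr : (0:ℝ) < n := by exact_mod_cast hn
  have hq : 0 < Real.sqrt s := Real.sqrt_pos.mpr hsp
  set t := l1norm (c - z) with htd
  have ht0 : 0 ≤ t := Finset.sum_nonneg fun i _ => abs_nonneg _
  have hb0 : 0 ≤ l2norm h := Real.sqrt_nonneg _
  set S : Finset (Fin m) := Finset.univ.filter fun i => z i ≠ 0 with hS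
  have hcard : (S.card : ℝ) ≤ s := by
    have : ({i | z i ≠ 0} : Set (Fin m)).ncard = S.card := by
      rw [← Set.ncard_coe_finset]; congr 1; ext i; simp [hS]
    have h2 : S.card ≤ s := by rw [← this]; exact hz
    exact_mod_cast h2
  have hSn : ∑ i ∈ S, |h i| ≤ Real.sqrt s * l2norm h := by
    unfold l2norm
    rw [← Real.sqrt_mul hsp.le]
    apply Real.le_sqrt_of_sq_le
    calc (∑ i ∈ S, |h i|) ^ 2 ≤ S.card * ∑ i ∈ S, |h i| ^ 2 := sq_sum_le_card_mul_sum_sq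
      _ ≤ s * ∑ i, h i ^ 2 := by
        simp only [sq_abs]
        apply mul_le_mul hcard _ (Finset.sum_nonneg fun i _ => sq_nonneg _) hsp.le
        exact Finset.sum_le_sum_of_subset_of_nonneg (Finset.subset_univ _) fun i _ _ => sq_nonneg _
  have hl1 : l1norm h ≤ 2 * (Real.sqrt s * l2norm h) + 2 * t := by
    have hp : ∀ i, |h i| ≤ |c i + h i| - |c i| + 2 * |(c - z) i| + 2 * (if i ∈ S then |h i| else 0) := by
      intro i
      by_cases hi : i ∈ S
      · simp only [hi, if_true]
        have h1 := abs_nonneg ((c - z) i)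
        have h2 : |c i| ≤ |c i + h i| + |h i| := by
          have := abs_sub (c i + h i) (h i); simpa using this
        linarith
      · have hzi : z i = 0 := by simpa [hS] using hi
        simp only [hi, if_false, Pi.sub_apply, hzi, sub_zero]
        have h2 : |h i| ≤ |c i + h i| + |c i| := by
          have := abs_sub (c i + h i) (c i); simpa using this
        linarith
    have := Finset.sum_le_sum fun i (_ : i ∈ Finset.univ) => hp i
    rw [Finset.sum_add_distrib, Finset.sum_add_distrib, Finset.sum_sub_distrib, ← Finset.mul_sum, ← Finset.mul_sum,
      Finset.sum_ite_mem, Finset.univ_inter] at this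
    have e1 : ∑ i, |h i| = l1norm h := rfl
    have e2 : ∑ i, |c i + h i| = l1norm (c + h) := rfl
    have e3 : ∑ i, |c i| = l1norm c := rfl
    have e4 : ∑ i, |(c - z) i| = t := rfl
    rw [e1, e2, e3, e4] at this
    linarith
  have h2 : l2norm h ≤ t / Real.sqrt s + 27 * ε := by
    have hd0 : 0 ≤ t / Real.sqrt s := by positivity
    rcases le_or_gt t (Real.sqrt s * l2norm h) with hcase | hcase
    · have h3 := hc h (by linarith)
      have h4 : l2norm h ^ 2 * n ≤ (27 * ε) ^ 2 * n := by nlinarith [mul_nonneg hnr.le (sq_nonneg ε)]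
      have h5 := le_of_mul_le_mul_right h4 hnr
      have h6 := abs_le_of_sq_le_sq h5 (by positivity)
      linarith [le_abs_self (l2norm h)]
    · have : l2norm h ≤ t / Real.sqrt s := by
        rw [le_div_iff₀ hq]; linarith
      linarith
  refine ⟨h2, ?_⟩
  have h7 := mul_le_mul_of_nonneg_left h2 hq.le
  have e : Real.sqrt s * (t / Real.sqrt s + 27 * ε) = t + 27 * Real.sqrt s * ε := by field_simp
  rw [e] at h7
  linarith

lemma recovery (s m n : ℕ) (hs : 2 ≤ s) (hn : 0 < n) (xs : Fin n → ℝ) (hc : ConeLB s m n xs)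
    (c : Fin m → ℝ) (ε : ℝ) (hε : 0 ≤ ε) (η : Fin n → ℝ) (hη : ∀ j, |Wdiag n xs j * η j| ≤ ε) (cstar : Fin m → ℝ)
    (hf : l2norm (fun j => Wdiag n xs j * ((legMatrix n m xs).mulVec cstar j -
        ((legMatrix n m xs).mulVec c j + η j))) ≤ Real.sqrt n * ε)
    (hmin : ∀ z : Fin m → ℝ, l2norm (fun j => Wdiag n xs j * ((legMatrix n m xs).mulVec z j -
        ((legMatrix n m xs).mulVec c j + η j))) ≤ Real.sqrt n * ε → l1norm cstar ≤ l1norm z) :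
    l2norm (c - cstar) ≤ 1 * bestApproxErr s c / Real.sqrt s + 27 * ε ∧
    l1norm (c - cstar) ≤ 4 * bestApproxErr s c + 54 * Real.sqrt s * ε := by
  have hsr : (2:ℝ) ≤ s := by exact_mod_cast hs
  have hsp : (0:ℝ) < s := by linarith
  have hq : 0 < Real.sqrt s := Real.sqrt_pos.mpr hsp
  have hnr : (0:ℝ) < n := by exact_mod_cast hn
  have hηs : ∑ j, (Wdiag n xs j * η j) ^ 2 ≤ n * ε ^ 2 := by
    calc ∑ j, (Wdiag n xs j * η j) ^ 2 ≤ ∑ j : Fin n, ε ^ 2 :=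
          Finset.sum_le_sum fun j _ => sq_le_sq' (abs_le.mp (hη j)).1 (abs_le.mp (hη j)).2
      _ = n * ε ^ 2 := by simp
  have hl : l1norm cstar ≤ l1norm c := by
    apply hmin
    unfold l2norm
    apply Real.sqrt_le_iff.mpr ⟨by positivity, ?_⟩
    rw [mul_pow, Real.sq_sqrt hnr.le]
    refine le_trans (le_of_eq ?_) hηs
    apply Finset.sum_congr rfl; intro j _; ring
  have hfs : ∑ j, (Wdiag n xs j * ((legMatrix n m xs).mulVec cstar j -
        ((legMatrix n m xs).mulVec c j + η j))) ^ 2 ≤ n * ε ^ 2 := by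
    have h1 := pow_le_pow_left₀ (Real.sqrt_nonneg _) hf 2
    rwa [← l2norm, l2norm_sq, mul_pow, Real.sq_sqrt hnr.le] at h1
  have ht : ∑ j, (Wdiag n xs j * (legMatrix n m xs).mulVec (cstar - c) j) ^ 2 ≤ 4 * (n * ε ^ 2) := by
    rw [Matrix.mulVec_sub]
    have hp : ∀ j, (Wdiag n xs j * ((legMatrix n m xs).mulVec cstar - (legMatrix n m xs).mulVec c) j) ^ 2 ≤
        2 * (Wdiag n xs j * ((legMatrix n m xs).mulVec cstar j - ((legMatrix n m xs).mulVec c j + η j))) ^ 2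
        + 2 * (Wdiag n xs j * η j) ^ 2 := by
      intro j
      rw [Pi.sub_apply]
      nlinarith [sq_nonneg (Wdiag n xs j * ((legMatrix n m xs).mulVec cstar j - ((legMatrix n m xs).mulVec c j + η j)) - Wdiag n xs j * η j)]
    have := Finset.sum_le_sum fun j (_ : j ∈ Finset.univ) => hp j
    rw [Finset.sum_add_distrib, ← Finset.mul_sum, ← Finset.mul_sum] at this
    linarith
  have key : ∀ z : Fin m → ℝ, IsSparse s z → l2norm (c - cstar) ≤ l1norm (c - z) / Real.sqrt s + 27 * ε ∧
      l1norm (c - cstar) ≤ 4 * l1norm (c - z) + 54 * Real.sqrt s * ε := by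
    intro z hz
    have h1 := recovery_one s m n hs hn xs hc c z (cstar - c) ε hε hz (by rw [add_sub_cancel]; exact hl) ht
    have e1 : l2norm (c - cstar) = l2norm (cstar - c) := by
      unfold l2norm; congr 1; apply Finset.sum_congr rfl; intro i _; simp only [Pi.sub_apply]; ring
    have e2 : l1norm (c - cstar) = l1norm (cstar - c) := by
      unfold l1norm; apply Finset.sum_congr rfl; intro i _; simp only [Pi.sub_apply]; rw [abs_sub_comm]
    rw [e1, e2]; exact h1
  have hne : {t : ℝ | ∃ z : Fin m → ℝ, IsSparse s z ∧ t = l1norm (c - z)}.Nonempty := by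
    refine ⟨_, 0, ?_, rfl⟩
    unfold IsSparse; simp
  have i1 : (l2norm (c - cstar) - 27 * ε) * Real.sqrt s ≤ bestApproxErr s c := by
    apply le_csInf hne
    rintro t ⟨z, hz, rfl⟩
    have := (key z hz).1
    rw [← le_div_iff₀ hq]; linarith
  have i2 : (l1norm (c - cstar) - 54 * Real.sqrt s * ε) / 4 ≤ bestApproxErr s c := by
    apply le_csInf hne
    rintro t ⟨z, hz, rfl⟩
    have := (key z hz).2
    linarith
  constructor
  · rw [← le_div_iff₀ hq] at i1
    rw [one_mul]; linarith
  · linarith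

/-- Recovery of sparse Legendre expansions.  There exist universal
constants `C, γ, C₁, C₂, D₁, D₂ > 0` such that for `s, m ≥ 2` and
`n ≥ C·s·(ln s)³·ln m`, with probability at least `1 − m^{−γ(ln s)³}` over `n` i.i.d.
Chebyshev samples `x_1,…,x_n`, simultaneously for all `c ∈ ℝ^m`, `ε ≥ 0` and `η` with
`‖Wη‖_∞ ≤ ε`: with `Y = Φc + η`, every minimizer `c*` of `‖z‖₁` over
`{z : ‖WΦz − WY‖₂ ≤ √n·ε}` satisfies
`‖c − c*‖₂ ≤ C₁·σ_s(c)₁/√s + D₁·ε` and `‖c − c*‖₁ ≤ C₂·σ_s(c)₁ + D₂·√s·ε`. -/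
theorem sparse_legendre_recovery :
    ∃ C γ C₁ C₂ D₁ D₂ : ℝ,
      0 < C ∧ 0 < γ ∧ 0 < C₁ ∧ 0 < C₂ ∧ 0 < D₁ ∧ 0 < D₂ ∧
      ∀ s m n : ℕ, 2 ≤ s → 2 ≤ m →
        C * s * (Real.log s) ^ 3 * Real.log m ≤ n →
        ENNReal.ofReal (1 - (m : ℝ) ^ (-(γ * (Real.log s) ^ 3))) ≤
          Measure.pi (fun _ : Fin n => chebMeasure)
            {xs : Fin n → ℝ |
              ∀ (c : Fin m → ℝ) (ε : ℝ), 0 ≤ ε →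
              ∀ η : Fin n → ℝ, (∀ j, |Wdiag n xs j * η j| ≤ ε) →
              ∀ cstar : Fin m → ℝ,
                l2norm (fun j => Wdiag n xs j *
                    ((legMatrix n m xs).mulVec cstar j -
                      ((legMatrix n m xs).mulVec c j + η j))) ≤ Real.sqrt n * ε →
                (∀ z : Fin m → ℝ,
                  l2norm (fun j => Wdiag n xs j *
                      ((legMatrix n m xs).mulVec z j -
                        ((legMatrix n m xs).mulVec c j + η j))) ≤ Real.sqrt n * ε →
                  l1norm cstar ≤ l1norm z) →
                l2norm (c - cstar) ≤ C₁ * bestApproxErr s c / Real.sqrt s + D₁ * ε ∧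
                l1norm (c - cstar) ≤ C₂ * bestApproxErr s c + D₂ * Real.sqrt s * ε} := by

  refine ⟨2 ^ 32, 2 ^ 13, 1, 4, 27, 54, by norm_num, by norm_num, by norm_num, by norm_num, by norm_num,
    by norm_num, ?_⟩
  intro s m n hs hm hn
  have hL := log_s_facts s hs
  have hΛ := log_s_facts m hm
  have hsr : (2:ℝ) ≤ s := by exact_mod_cast hs
  have hnr : (0:ℝ) < n := by
    refine lt_of_lt_of_le ?_ hn
    have h1 : 0 < Real.log s := by linarith
    have h2 : 0 < Real.log m := by linarith
    positivity
  have hn0 : 0 < n := by exact_mod_cast hnr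
  have hbad := bos chebMeasure (fun k : Fin m => psi (k : ℕ)) (fun k => psi_measurable k)
    (fun k x => psi_bound k x) s n hs hm hn
  set μ := Measure.pi (fun _ : Fin n => chebMeasure) with hμ
  set bad : Set (Fin n → ℝ) := {xs | ¬ ∀ u : Fin m → ℝ, ∑ k, |u k| = 1 →
      ∫ x, (∑ k, u k * psi (k : ℕ) x) ^ 2 ∂chebMeasure ≤
        43 * ((∑ j, (∑ k, u k * psi (k : ℕ) (xs j)) ^ 2) / n) + 3 / (1024 * s)} with hbd
  have hae : ∀ᵐ xs ∂μ, ∀ j, xs j ∈ Set.Ioo (-1:ℝ) 1 := by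
    rw [ae_all_iff]
    intro j
    exact (measurePreserving_eval (fun _ : Fin n => chebMeasure) j).quasiMeasurePreserving.ae cheb_ae
  have hnull : μ {xs | ¬ ∀ j, xs j ∈ Set.Ioo (-1:ℝ) 1} = 0 := ae_iff.mp hae
  set G : Set (Fin n → ℝ) := {xs | ConeLB s m n xs} with hG
  have hcov : (Set.univ : Set (Fin n → ℝ)) ⊆ (G ∪ bad) ∪ {xs | ¬ ∀ j, xs j ∈ Set.Ioo (-1:ℝ) 1} := by
    intro xs _
    by_cases h1 : xs ∈ bad
    · exact Or.inl (Or.inr h1)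
    · by_cases h2 : ∀ j, xs j ∈ Set.Ioo (-1:ℝ) 1
      · exact Or.inl (Or.inl (cone_of_good s m n hs hn0 xs h2 (not_not.mp h1)))
      · exact Or.inr h2
  have hGm : ENNReal.ofReal (1 - (m : ℝ) ^ (-((2:ℝ) ^ 13 * Real.log s ^ 3))) ≤ μ G := by
    have h1 : (1:ENNReal) ≤ μ G + μ bad := by
      calc (1:ENNReal) = μ Set.univ := measure_univ.symm
        _ ≤ μ ((G ∪ bad) ∪ {xs | ¬ ∀ j, xs j ∈ Set.Ioo (-1:ℝ) 1}) := measure_mono hcov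
        _ ≤ μ (G ∪ bad) + μ {xs | ¬ ∀ j, xs j ∈ Set.Ioo (-1:ℝ) 1} := measure_union_le _ _
        _ = μ (G ∪ bad) := by rw [hnull, add_zero]
        _ ≤ _ := measure_union_le _ _
    have h2 : μ bad ≤ ENNReal.ofReal ((m : ℝ) ^ (-((2:ℝ) ^ 13 * Real.log s ^ 3))) := by
      rw [← ofReal_measureReal (measure_ne_top μ bad)]
      exact ENNReal.ofReal_le_ofReal hbad
    rw [ENNReal.ofReal_sub _ (by positivity), ENNReal.ofReal_one]
    exact tsub_le_iff_right.mpr (h1.trans (by gcongr))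
  refine hGm.trans (measure_mono ?_)
  intro xs hxs c ε hε η hη cstar hf hmin
  exact recovery s m n hs hn0 xs hxs c ε hε η hη cstar hf hmin
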